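/- arXiv:1906.01715 — 4 statements merged into one kernel-verified Lean document; each statement's English description precedes it below -/
import Mathlib

section
/- Let K̂ = K̂_φ ⊂ ℝ^d be a reference generalized prism with parameter r̂, and set C_inv^B(d, r̂) := 64(d−1)·r̂(r̂+1)(2r̂+1) + 12d. Then for every p ∈ ℕ and every real polynomial v of total degree at most p in d variables, ∫_{K̂} |∇v|² dx ≤ C_inv^B(d, r̂) · p⁴ · ∫_{K̂} v² dx. -/
open MeasureTheory

/-- The closed unit cube `[0,1]^k` in `ℝ^k` (as a plain function space). -/
def unitCube (k : ℕ) : Set (Fin k → ℝ) := {y | ∀ i, y i ∈ Set.Icc (0 : ℝ) 1}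

/-- The generalized prism `K̂_φ ⊂ ℝ^{m+1}` determined by a graph function
`φ : [0,1]^m → ℝ`:  `{x : 0 ≤ x_i ≤ 1 (i < d), 0 ≤ x_d ≤ φ(x_1,…,x_{d-1})}`, `d = m+1`. -/
def prism (m : ℕ) (φ : (Fin m → ℝ) → ℝ) : Set (EuclideanSpace ℝ (Fin (m + 1))) :=
  {x | (∀ i : Fin m, x (Fin.castSucc i) ∈ Set.Icc (0 : ℝ) 1) ∧
    x (Fin.last m) ∈ Set.Icc (0 : ℝ) (φ (fun i => x (Fin.castSucc i)))}

/-- The flat base `F̂⁰ = [0,1]^m × {0}` of a generalized prism. -/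
def flatBase (m : ℕ) : Set (EuclideanSpace ℝ (Fin (m + 1))) :=
  {x | (∀ i : Fin m, x (Fin.castSucc i) ∈ Set.Icc (0 : ℝ) 1) ∧ x (Fin.last m) = 0}

/-- The curved base `F̂ = {(x', φ(x')) : x' ∈ [0,1]^m}` of a generalized prism. -/
def curvedBase (m : ℕ) (φ : (Fin m → ℝ) → ℝ) : Set (EuclideanSpace ℝ (Fin (m + 1))) :=
  {x | (∀ i : Fin m, x (Fin.castSucc i) ∈ Set.Icc (0 : ℝ) 1) ∧
    x (Fin.last m) = φ (fun i => x (Fin.castSucc i))}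

/-- `K̂_φ` is a *reference generalized prism*: `φ` is Lipschitz, the unit cube `[0,1]^{m+1}`
is contained in `K̂_φ`, and every segment joining a point of the flat base to a point of the
curved base lies in `K̂_φ` (star-shapedness of `F̂⁰` with respect to `F̂`). -/
def IsRefGenPrism (m : ℕ) (φ : (Fin m → ℝ) → ℝ) : Prop :=
  (∃ L : NNReal, LipschitzWith L φ) ∧
  ({x : EuclideanSpace ℝ (Fin (m + 1)) | ∀ i, x i ∈ Set.Icc (0 : ℝ) 1} ⊆ prism m φ) ∧
  (∀ x ∈ flatBase m, ∀ y ∈ curvedBase m φ, segment ℝ x y ⊆ prism m φ)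

/-- The parameter `r̂ := ⌊max_{[0,1]^m} φ⌋ + 1` of a reference generalized prism. -/
noncomputable def rhat (m : ℕ) (φ : (Fin m → ℝ) → ℝ) : ℕ :=
  Nat.floor (sSup (φ '' unitCube m)) + 1

/-- The constant `C_inv^B(d, r̂) = 64(d-1)r̂(r̂+1)(2r̂+1) + 12d`. -/
def CinvB (d r : ℕ) : ℝ :=
  64 * ((d : ℝ) - 1) * (r : ℝ) * ((r : ℝ) + 1) * (2 * (r : ℝ) + 1) + 12 * (d : ℝ)

theorem lintegral_eq_lintegral_slab {ι : Type*} [Fintype ι] (F : EuclideanSpace ℝ ι → ENNReal)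
    (hF : Measurable F) (w : EuclideanSpace ℝ ι) (j : ι) (hw : w j = 1 ∨ w j = -1) :
    ∫⁻ x, F x = ∫⁻ x, {x : EuclideanSpace ℝ ι | x j ∈ Set.Ico (0 : ℝ) 1}.indicator 1 x *
      ∫⁻ t : ℝ, F (x + t • w) := by
  set S := {x : EuclideanSpace ℝ ι | x j ∈ Set.Ico (0 : ℝ) 1}
  have hS : MeasurableSet S := by
    have : Measurable fun x : EuclideanSpace ℝ ι => x j := by fun_prop
    exact this measurableSet_Ico
  have hψ : Measurable (S.indicator (1 : EuclideanSpace ℝ ι → ENNReal)) :=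
    measurable_one.indicator hS
  have hunit (x : EuclideanSpace ℝ ι) :
      ∫⁻ t : ℝ, S.indicator (1 : EuclideanSpace ℝ ι → ENNReal) (x - t • w) = 1 := by
    have hline : Measurable fun t : ℝ => x - t • w := by fun_prop
    have : (fun t : ℝ => S.indicator (1 : EuclideanSpace ℝ ι → ENNReal) (x - t • w)) =
        ((fun t : ℝ => x - t • w) ⁻¹' S).indicator 1 := rfl
    rw [this, lintegral_indicator_one (hline hS)]
    rcases hw with h | h
    · have : (fun t : ℝ => x - t • w) ⁻¹' S = Set.Ioc (x j - 1) (x j) := by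
        ext t
        simp only [S, Set.mem_preimage, Set.mem_ofPred_eq, PiLp.sub_apply, PiLp.smul_apply, h,
          smul_eq_mul, Set.mem_Ico, Set.mem_Ioc]
        constructor <;> rintro ⟨_, _⟩ <;> constructor <;> linarith
      rw [this]; simp
    · have : (fun t : ℝ => x - t • w) ⁻¹' S = Set.Ico (-x j) (1 - x j) := by
        ext t
        simp only [S, Set.mem_preimage, Set.mem_ofPred_eq, PiLp.sub_apply, PiLp.smul_apply, h,
          smul_eq_mul, Set.mem_Ico]
        constructor <;> rintro ⟨_, _⟩ <;> constructor <;> linarith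
      rw [this]; simp
  calc ∫⁻ x, F x = ∫⁻ x, ∫⁻ t : ℝ, S.indicator 1 (x - t • w) * F x := by
        refine lintegral_congr fun x => ?_
        rw [lintegral_mul_const _ (by fun_prop), hunit, one_mul]
    _ = ∫⁻ t : ℝ, ∫⁻ x, S.indicator 1 (x - t • w) * F x :=
        lintegral_lintegral_swap (by unfold Function.uncurry; fun_prop)
    _ = ∫⁻ t : ℝ, ∫⁻ x, S.indicator 1 x * F (x + t • w) := by
        refine lintegral_congr fun t => ?_
        rw [← lintegral_add_right_eq_self _ (t • w)]
        simp
    _ = ∫⁻ x, ∫⁻ t : ℝ, S.indicator 1 x * F (x + t • w) :=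
        lintegral_lintegral_swap (by unfold Function.uncurry; fun_prop)
    _ = _ := by
        refine lintegral_congr fun x => ?_
        rw [lintegral_const_mul _ (by fun_prop)]

theorem lintegral_le_of_forall_line {ι : Type*} [Fintype ι] {F G : EuclideanSpace ℝ ι → ENNReal}
    (hF : Measurable F) (hG : Measurable G) {w : EuclideanSpace ℝ ι} {j : ι}
    (hw : w j = 1 ∨ w j = -1) {C : ENNReal}
    (h : ∀ x, ∫⁻ t : ℝ, G (x + t • w) ≤ C * ∫⁻ t : ℝ, F (x + t • w)) :
    ∫⁻ x, G x ≤ C * ∫⁻ x, F x := by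
  rw [lintegral_eq_lintegral_slab F hF w j hw, lintegral_eq_lintegral_slab G hG w j hw]
  have hm : Measurable fun x => {x : EuclideanSpace ℝ ι | x j ∈ Set.Ico (0 : ℝ) 1}.indicator 1 x *
      ∫⁻ t : ℝ, F (x + t • w) := by
    refine Measurable.mul (measurable_one.indicator ?_) ?_
    · have : Measurable fun x : EuclideanSpace ℝ ι => x j := by fun_prop
      exact this measurableSet_Ico
    · exact Measurable.lintegral_prod_right' (f := fun z : EuclideanSpace ℝ ι × ℝ =>
        F (z.1 + z.2 • w)) (by fun_prop)
  rw [← lintegral_const_mul _ hm]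
  refine lintegral_mono fun x => ?_
  rw [mul_left_comm]
  gcongr
  exact h x

section

open Polynomial

/-- The functional `f ↦ ∫₀¹ f` on real polynomials. -/
noncomputable def unitIntegral : ℝ[X] →ₗ[ℝ] ℝ where
  toFun f := ∫ t in (0 : ℝ)..1, f.eval t
  map_add' f g := by
    simp only [eval_add]
    exact intervalIntegral.integral_add (f.continuous.intervalIntegrable _ _)
      (g.continuous.intervalIntegrable _ _)
  map_smul' c f := by simp [eval_smul]

theorem unitIntegral_apply (f : ℝ[X]) : unitIntegral f = ∫ t in (0 : ℝ)..1, f.eval t := rfl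

theorem unitIntegral_derivative (f : ℝ[X]) :
    unitIntegral (derivative f) = f.eval 1 - f.eval 0 := by
  rw [unitIntegral_apply]
  exact intervalIntegral.integral_eq_sub_of_hasDerivAt (fun t _ => f.hasDerivAt t)
    ((derivative f).continuous.intervalIntegrable _ _)

theorem unitIntegral_mul_self_nonneg (f : ℝ[X]) : 0 ≤ unitIntegral (f * f) := by
  rw [unitIntegral_apply]
  refine intervalIntegral.integral_nonneg zero_le_one fun t _ => ?_
  rw [eval_mul]
  exact mul_self_nonneg _

theorem eq_zero_of_unitIntegral_mul_self {f : ℝ[X]} (hf : unitIntegral (f * f) = 0) : f = 0 := by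
  by_contra hne
  obtain ⟨c, hc, hfc⟩ : ∃ c ∈ Set.Icc (0 : ℝ) 1, f.eval c ≠ 0 := by
    by_contra! h
    exact hne (Polynomial.eq_zero_of_infinite_isRoot f
      ((Set.Icc_infinite (zero_lt_one (α := ℝ))).mono h))
  refine (intervalIntegral.integral_pos (zero_lt_one (α := ℝ)) (f * f).continuous.continuousOn
    (fun t _ => ?_) ⟨c, hc, ?_⟩).ne' hf
  · rw [eval_mul]; exact mul_self_nonneg _
  · rw [eval_mul]; exact mul_self_pos.2 hfc

theorem exists_unitIntegral_projection (n : ℕ) (f : ℝ[X]) :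
    ∃ g ∈ degreeLT ℝ n, ∀ q ∈ degreeLT ℝ n, unitIntegral ((f - g) * q) = 0 := by
  let B : ℝ[X] →ₗ[ℝ] ℝ[X] →ₗ[ℝ] ℝ := (LinearMap.mul ℝ ℝ[X]).compr₂ unitIntegral
  have hB (a b : ℝ[X]) : B a b = unitIntegral (a * b) := rfl
  let T : degreeLT ℝ n →ₗ[ℝ] Module.Dual ℝ (degreeLT ℝ n) :=
    B.domRestrict₁₂ (degreeLT ℝ n) (degreeLT ℝ n)
  have : FiniteDimensional ℝ (degreeLT ℝ n) :=
    Module.Finite.equiv (degreeLTEquiv ℝ n).symm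
  have hinj : Function.Injective T := by
    rw [injective_iff_map_eq_zero]
    intro a ha
    have h : unitIntegral (a.1 * a.1) = 0 := LinearMap.congr_fun ha a
    exact Subtype.ext (eq_zero_of_unitIntegral_mul_self h)
  have hsurj : Function.Surjective T :=
    (LinearMap.injective_iff_surjective_of_finrank_eq_finrank
      Subspace.dual_finrank_eq.symm).1 hinj
  obtain ⟨g, hg⟩ := hsurj ((B f).domRestrict (degreeLT ℝ n))
  refine ⟨g, g.2, fun q hq => ?_⟩
  have h : unitIntegral (g.1 * q) = unitIntegral (f * q) := LinearMap.congr_fun hg ⟨q, hq⟩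
  rw [sub_mul, map_sub, h, sub_self]

theorem X_mul_derivative_sub_mem_degreeLT {n : ℕ} {h : ℝ[X]} (hd : h.natDegree ≤ n) :
    X * derivative h - C (n : ℝ) * h ∈ degreeLT ℝ n := by
  rw [mem_degreeLT, degree_lt_iff_coeff_zero]
  intro k hk
  rcases k with _ | k
  · simp [Nat.le_zero.1 hk]
  · simp only [coeff_sub, coeff_X_mul, coeff_derivative, coeff_C_mul]
    rcases hk.eq_or_lt with rfl | hk
    · push_cast; ring
    · simp [coeff_eq_zero_of_natDegree_lt (hd.trans_lt hk)]

theorem legendre_operator_sub_mem_degreeLT {n : ℕ} {h : ℝ[X]} (hd : h.natDegree ≤ n) :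
    derivative ((X ^ 2 - X) * derivative h) - C ((n : ℝ) * (n + 1)) * h ∈ degreeLT ℝ n := by
  rw [mem_degreeLT, degree_lt_iff_coeff_zero]
  intro k hk
  rw [show (X ^ 2 - X) * derivative h = X * (X * derivative h) - X * derivative h by ring]
  have hk1 : h.coeff (k + 1) = 0 := coeff_eq_zero_of_natDegree_lt (by omega)
  rcases k with _ | k
  · simp only [coeff_sub, coeff_X_mul, coeff_derivative, coeff_C_mul, hk1, Nat.le_zero.1 hk]
    simp
  · simp only [coeff_sub, coeff_X_mul, coeff_derivative, coeff_C_mul, hk1]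
    rcases hk.eq_or_lt with rfl | hk
    · push_cast; ring
    · simp [coeff_eq_zero_of_natDegree_lt (hd.trans_lt hk)]

theorem derivative_mem_degreeLT {n : ℕ} {h : ℝ[X]} (hd : h.natDegree ≤ n) :
    derivative h ∈ degreeLT ℝ n := by
  rw [mem_degreeLT, degree_lt_iff_coeff_zero]
  intro k hk
  rw [coeff_derivative, coeff_eq_zero_of_natDegree_lt (by omega), zero_mul]

theorem natDegree_le_of_mem_degreeLT {n : ℕ} {q : ℝ[X]} (hq : q ∈ degreeLT ℝ n) :
    q.natDegree ≤ n :=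
  natDegree_le_of_degree_le (mem_degreeLT.1 hq).le

theorem unitIntegral_legendre_operator_mul (f g : ℝ[X]) :
    unitIntegral (derivative ((X ^ 2 - X) * derivative f) * g) =
      unitIntegral (f * derivative ((X ^ 2 - X) * derivative g)) := by
  have h := unitIntegral_derivative
    ((X ^ 2 - X) * derivative f * g - f * ((X ^ 2 - X) * derivative g))
  have e : derivative ((X ^ 2 - X) * derivative f * g - f * ((X ^ 2 - X) * derivative g)) =
      derivative ((X ^ 2 - X) * derivative f) * g -
        f * derivative ((X ^ 2 - X) * derivative g) := by
    rw [derivative_sub, derivative_mul (f := (X ^ 2 - X) * derivative f),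
      derivative_mul (f := f)]
    ring
  rw [e, map_sub] at h
  rw [← sub_eq_zero, h]
  simp

theorem legendre_equation {n : ℕ} {h : ℝ[X]} (hd : h.natDegree ≤ n)
    (ho : ∀ q ∈ degreeLT ℝ n, unitIntegral (h * q) = 0) :
    derivative ((X ^ 2 - X) * derivative h) = C ((n : ℝ) * (n + 1)) * h := by
  have hD := legendre_operator_sub_mem_degreeLT hd
  rw [← sub_eq_zero]
  set D := derivative ((X ^ 2 - X) * derivative h) - C ((n : ℝ) * (n + 1)) * h with hDdef
  apply eq_zero_of_unitIntegral_mul_self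
  have hLD := legendre_operator_sub_mem_degreeLT (natDegree_le_of_mem_degreeLT hD)
  have h1 := ho _ hLD
  have h2 := ho _ hD
  have e1 : D * D = derivative ((X ^ 2 - X) * derivative h) * D -
      ((n : ℝ) * (n + 1)) • (h * D) := by
    rw [smul_eq_C_mul]
    nth_rewrite 1 [hDdef]
    ring
  have e2 : h * (derivative ((X ^ 2 - X) * derivative D) - C ((n : ℝ) * (n + 1)) * D) =
      h * derivative ((X ^ 2 - X) * derivative D) - ((n : ℝ) * (n + 1)) • (h * D) := by
    rw [smul_eq_C_mul]
    ring
  rw [e2, map_sub, map_smul, h2] at h1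
  rw [e1, map_sub, map_smul, h2, unitIntegral_legendre_operator_mul]
  exact h1

theorem unitIntegral_derivative_sq_of_orthogonal {n : ℕ} {h : ℝ[X]} (hd : h.natDegree ≤ n)
    (ho : ∀ q ∈ degreeLT ℝ n, unitIntegral (h * q) = 0) :
    unitIntegral (derivative h * derivative h) =
      2 * n * (n + 1) * (2 * n + 1) * unitIntegral (h * h) := by
  have hd' := derivative_mem_degreeLT hd
  have h1 : unitIntegral (h * derivative h) = 0 := ho _ hd'
  have h2 : unitIntegral (h * derivative (derivative h)) = 0 :=
    ho _ (derivative_mem_degreeLT (natDegree_le_of_mem_degreeLT hd'))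
  have h3 : unitIntegral (X * h * derivative h) = n * unitIntegral (h * h) := by
    have := ho _ (X_mul_derivative_sub_mem_degreeLT hd)
    rw [show h * (X * derivative h - C (n : ℝ) * h) = X * h * derivative h - (n : ℝ) • (h * h) by
      rw [smul_eq_C_mul]; ring, map_sub, map_smul, smul_eq_mul] at this
    linarith
  have hone := unitIntegral_derivative (X * (h * h))
  have hzero := unitIntegral_derivative ((X - 1) * (h * h))
  have hbd := unitIntegral_derivative (h * derivative h)
  rw [show derivative (X * (h * h)) = h * h + (2 : ℝ) • (X * h * derivative h) by
    rw [smul_eq_C_mul, derivative_mul, derivative_mul, derivative_X, C_ofNat]; ring,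
    map_add, map_smul, h3, smul_eq_mul] at hone
  rw [show derivative ((X - 1) * (h * h)) = h * h + (2 : ℝ) • (X * h * derivative h) -
      (2 : ℝ) • (h * derivative h) by
    rw [smul_eq_C_mul, smul_eq_C_mul, derivative_mul, derivative_mul, derivative_sub, derivative_X,
      derivative_one, C_ofNat]; ring,
    map_sub, map_add, map_smul, map_smul, h3, h1, smul_eq_mul] at hzero
  rw [derivative_mul, map_add, h2] at hbd
  have heq := legendre_equation hd ho
  have e1 := congrArg (eval 1) heq
  have e0 := congrArg (eval 0) heq
  simp [derivative_mul] at e1 e0 hone hzero hbd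
  rw [hbd]
  have e1' : eval 1 (derivative h) = n * (n + 1) * eval 1 h := by linarith
  have e0' : eval 0 (derivative h) = -(n * (n + 1) * eval 0 h) := by linarith
  rw [e1', e0']
  linear_combination (-(n : ℝ) * (n + 1)) * (hone + hzero)

theorem unitIntegral_derivative_sq_le (n : ℕ) (f : ℝ[X]) (hf : f.natDegree ≤ n) :
    unitIntegral (derivative f * derivative f) ≤
      n * (n + 1) ^ 2 * (n + 2) * unitIntegral (f * f) := by
  induction n generalizing f with
  | zero =>
    rw [eq_C_of_natDegree_le_zero hf]
    simp
  | succ n ih =>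
    obtain ⟨g, hg, ho⟩ := exists_unitIntegral_projection (n + 1) f
    have hgn : g.natDegree ≤ n := by
      by_cases h0 : g = 0
      · simp [h0]
      · exact Nat.lt_succ_iff.1 ((natDegree_lt_iff_degree_lt h0).2 (mem_degreeLT.1 hg))
    obtain ⟨h, rfl⟩ : ∃ h, f = g + h := ⟨f - g, by ring⟩
    rw [add_sub_cancel_left] at ho
    have hd : h.natDegree ≤ n + 1 := by
      have := natDegree_sub_le (g + h) g
      rw [add_sub_cancel_left] at this
      omega
    have hA := ih g hgn
    have hB := unitIntegral_derivative_sq_of_orthogonal hd ho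
    have hgh := ho g hg
    have hG := unitIntegral_mul_self_nonneg g
    have hH := unitIntegral_mul_self_nonneg h
    rw [show (g + h) * (g + h) = g * g + (2 : ℝ) • (h * g) + h * h by
      rw [smul_eq_C_mul, C_ofNat]; ring, derivative_add,
      show (derivative g + derivative h) * (derivative g + derivative h) =
        derivative g * derivative g + (2 : ℝ) • (derivative g * derivative h) +
          derivative h * derivative h by
      rw [smul_eq_C_mul, C_ofNat]; ring]
    simp only [map_add, map_smul, hgh, smul_eq_mul]
    push_cast at hB ⊢
    rcases Nat.eq_zero_or_pos n with rfl | hn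
    · have hg0 : derivative g = 0 := by
        rw [eq_C_of_natDegree_le_zero hgn, derivative_C]
      rw [hB, hg0]
      simp
      nlinarith
    · set α : ℝ := n * (n + 1) ^ 2 * (n + 2) with hα
      set β : ℝ := 2 * (n + 1) * (n + 1 + 1) * (2 * (n + 1) + 1) with hβ
      have hαp : 0 < α := by positivity
      have hβp : 0 < β := by positivity
      have hsq := unitIntegral_mul_self_nonneg (β • derivative g - α • derivative h)
      rw [show (β • derivative g - α • derivative h) * (β • derivative g - α • derivative h) =
        (β ^ 2) • (derivative g * derivative g) - (2 * α * β) • (derivative g * derivative h) +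
          (α ^ 2) • (derivative h * derivative h) by
        simp only [smul_eq_C_mul, C_mul, C_pow, C_ofNat]; ring] at hsq
      simp only [map_add, map_sub, map_smul, smul_eq_mul] at hsq
      have hsum : ((n : ℝ) + 1) * (n + 1 + 1) ^ 2 * (n + 1 + 2) = α + β := by
        rw [hα, hβ]; ring
      rw [hsum]
      refine le_of_mul_le_mul_left ?_ (mul_pos hαp hβp)
      rw [hB] at hsq ⊢
      nlinarith [mul_le_mul_of_nonneg_left hA (mul_pos (add_pos hαp hβp) hβp).le]

theorem integral_derivative_sq_le {p : ℕ} {f : ℝ[X]} (hf : f.natDegree ≤ p) {a b : ℝ}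
    (hab : a < b) :
    ∫ t in a..b, (derivative f).eval t ^ 2 ≤
      12 * p ^ 4 / (b - a) ^ 2 * ∫ t in a..b, f.eval t ^ 2 := by
  have hl : 0 < b - a := sub_pos.2 hab
  have hu (q : ℝ[X]) : ∫ t in a..b, q.eval t ^ 2 =
      (b - a) * unitIntegral (q.comp (C (b - a) * X + C a) * q.comp (C (b - a) * X + C a)) := by
    rw [unitIntegral_apply]
    have := intervalIntegral.mul_integral_comp_mul_add (a := 0) (b := 1)
      (f := fun t => q.eval t ^ 2) (b - a) a
    simp only [mul_zero, zero_add, mul_one, sub_add_cancel] at this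
    rw [← this]
    simp [pow_two]
  have hcomp : (f.comp (C (b - a) * X + C a)).natDegree ≤ p := by
    refine (natDegree_comp_le).trans ?_
    exact (Nat.mul_le_mul hf natDegree_linear_le).trans (mul_one p).le
  have key := unitIntegral_derivative_sq_le p _ hcomp
  rw [derivative_comp] at key
  simp only [derivative_add, derivative_mul, derivative_C, derivative_X, zero_mul, zero_add,
    add_zero, mul_one] at key
  rw [hu, hu]
  set q := f.comp (C (b - a) * X + C a)
  set q' := (derivative f).comp (C (b - a) * X + C a)
  rw [show C (b - a) * q' * (C (b - a) * q') = ((b - a) ^ 2) • (q' * q') by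
    rw [smul_eq_C_mul, C_pow]; ring, map_smul, smul_eq_mul] at key
  have hp : (p : ℝ) * (p + 1) ^ 2 * (p + 2) ≤ 12 * p ^ 4 := by
    rcases Nat.eq_zero_or_pos p with rfl | hp
    · simp
    · have : (1 : ℝ) ≤ p := by exact_mod_cast hp
      calc (p : ℝ) * (p + 1) ^ 2 * (p + 2) ≤ (p : ℝ) * (p + p) ^ 2 * (p + (p + p)) := by
            gcongr; linarith
        _ = 12 * (p : ℝ) ^ 4 := by ring
  have key2 := key.trans (mul_le_mul_of_nonneg_right hp (unitIntegral_mul_self_nonneg q))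
  rw [mul_left_comm]
  gcongr
  rw [div_mul_eq_mul_div, le_div_iff₀ (by positivity)]
  linarith

/-- The restriction of multivariate polynomials to the line `t ↦ x + t • w`. -/
noncomputable def lineRestrict {ι : Type*} (x w : ι → ℝ) : MvPolynomial ι ℝ →ₐ[ℝ] ℝ[X] :=
  MvPolynomial.aeval fun j => C (x j) + C (w j) * X

theorem lineRestrict_X {ι : Type*} (x w : ι → ℝ) (j : ι) :
    lineRestrict x w (MvPolynomial.X j) = C (x j) + C (w j) * X :=
  MvPolynomial.aeval_X _ _

theorem eval_lineRestrict {ι : Type*} (v : MvPolynomial ι ℝ) (x w : ι → ℝ) (t : ℝ) :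
    (lineRestrict x w v).eval t = MvPolynomial.eval (fun j => x j + t * w j) v := by
  induction v using MvPolynomial.induction_on with
  | C a =>
    rw [← MvPolynomial.algebraMap_eq, AlgHom.commutes, MvPolynomial.algebraMap_eq,
      MvPolynomial.eval_C, ← C_eq_algebraMap, eval_C]
  | add f g hf hg => rw [map_add, eval_add, hf, hg, map_add]
  | mul_X f i hf =>
    rw [map_mul, eval_mul, hf, map_mul, lineRestrict_X, MvPolynomial.eval_X, eval_add, eval_mul,
      eval_C, eval_C, eval_X, mul_comm (w i)]

theorem derivative_lineRestrict {ι : Type*} [Fintype ι] (v : MvPolynomial ι ℝ) (x w : ι → ℝ) :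
    derivative (lineRestrict x w v) =
      ∑ j, C (w j) * lineRestrict x w (MvPolynomial.pderiv j v) := by
  classical
  induction v using MvPolynomial.induction_on with
  | C a =>
    rw [← MvPolynomial.algebraMap_eq, AlgHom.commutes, ← C_eq_algebraMap, derivative_C]
    simp
  | add f g hf hg => simp only [map_add, mul_add, Finset.sum_add_distrib, hf, hg]
  | mul_X f i hf =>
    have hX : derivative (lineRestrict x w (MvPolynomial.X i)) = C (w i) := by
      simp [lineRestrict_X]
    simp only [map_mul, derivative_mul, hf, hX, Derivation.leibniz, map_add, smul_eq_mul,
      MvPolynomial.pderiv_X, mul_add, Finset.sum_add_distrib]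
    rw [add_comm]
    congr 1
    · rw [Finset.sum_eq_single i]
      · rw [Pi.single_eq_same, map_one, mul_one, mul_comm]
      · intro j _ hj
        rw [Pi.single_eq_of_ne hj.symm, map_zero, mul_zero, mul_zero]
      · simp
    · rw [Finset.sum_mul]
      refine Finset.sum_congr rfl fun j _ => ?_
      ring

theorem natDegree_lineRestrict_le {ι : Type*} {v : MvPolynomial ι ℝ} {p : ℕ}
    (hv : v.totalDegree ≤ p) (x w : ι → ℝ) : (lineRestrict x w v).natDegree ≤ p := by
  have := MvPolynomial.aeval_natDegree_le v hv (fun j => C (x j) + C (w j) * X)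
    (n := 1) fun j => by rw [add_comm]; exact natDegree_linear_le
  rwa [mul_one] at this

theorem continuous_eval_mvPolynomial {ι : Type*} [Fintype ι] (v : MvPolynomial ι ℝ) :
    Continuous fun x : EuclideanSpace ℝ ι => MvPolynomial.eval (fun j => x j) v :=
  (MvPolynomial.continuous_eval v).comp (PiLp.continuous_ofLp 2 _)

theorem lintegral_Icc_ofReal {g : ℝ → ℝ} (hg : Continuous g)
    (hg0 : ∀ t, 0 ≤ g t) {a b : ℝ} (hab : a ≤ b) :
    ∫⁻ t in Set.Icc a b, ENNReal.ofReal (g t) = ENNReal.ofReal (∫ t in a..b, g t) := by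
  rw [intervalIntegral.integral_of_le hab, ← integral_Icc_eq_integral_Ioc,
    ofReal_integral_eq_lintegral_ofReal (hg.continuousOn.integrableOn_Icc)
      (Filter.Eventually.of_forall hg0)]

/-- Directional inverse estimate: every line in direction `w` which meets `A` does so inside an
interval of parameter length at least `l` that is contained in `K`. -/
theorem integral_directional_derivative_sq_le {ι : Type*} [Fintype ι]
    {A K : Set (EuclideanSpace ℝ ι)} (hA : IsCompact A) (hK : IsCompact K)
    {w : EuclideanSpace ℝ ι} {j : ι} (hw : w j = 1 ∨ w j = -1) {l : ℝ} (hl : 0 < l)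
    (hline : ∀ x ∈ A, ∃ a b : ℝ, l ≤ b - a ∧ (∀ t : ℝ, x + t • w ∈ A → t ∈ Set.Icc a b) ∧
      ∀ t ∈ Set.Icc a b, x + t • w ∈ K)
    {v : MvPolynomial ι ℝ} {p : ℕ} (hv : v.totalDegree ≤ p) :
    ∫ x in A, (∑ i, w i * MvPolynomial.eval (fun j => x j) (MvPolynomial.pderiv i v)) ^ 2 ≤
      12 * p ^ 4 / l ^ 2 * ∫ x in K, (MvPolynomial.eval (fun j => x j) v) ^ 2 := by
  have hvc : Continuous fun x : EuclideanSpace ℝ ι =>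
      (MvPolynomial.eval (fun j => x j) v) ^ 2 := (continuous_eval_mvPolynomial v).pow 2
  have hdc : Continuous fun x : EuclideanSpace ℝ ι =>
      (∑ i, w i * MvPolynomial.eval (fun j => x j) (MvPolynomial.pderiv i v)) ^ 2 :=
    (continuous_finsetSum _ fun i _ =>
      continuous_const.mul (continuous_eval_mvPolynomial _)).pow 2
  have hC : 0 ≤ 12 * (p : ℝ) ^ 4 / l ^ 2 := by positivity
  refine (ENNReal.ofReal_le_ofReal_iff
    (mul_nonneg hC (integral_nonneg fun _ => sq_nonneg _))).1 ?_
  rw [ENNReal.ofReal_mul hC,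
    ofReal_integral_eq_lintegral_ofReal (hdc.continuousOn.integrableOn_compact hA)
      (Filter.Eventually.of_forall fun _ => sq_nonneg _),
    ofReal_integral_eq_lintegral_ofReal (hvc.continuousOn.integrableOn_compact hK)
      (Filter.Eventually.of_forall fun _ => sq_nonneg _),
    ← lintegral_indicator hA.measurableSet, ← lintegral_indicator hK.measurableSet]
  refine lintegral_le_of_forall_line
    (hvc.measurable.ennreal_ofReal.indicator hK.measurableSet)
    (hdc.measurable.ennreal_ofReal.indicator hA.measurableSet) hw fun x => ?_
  by_cases hx : ∃ s : ℝ, x + s • w ∈ A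
  swap
  · push Not at hx
    simp [hx]
  obtain ⟨s, hs⟩ := hx
  obtain ⟨a, b, hab, h1, h2⟩ := hline _ hs
  have hle : a + s < b + s := by linarith
  have hle' : b + s - (a + s) = b - a := by ring
  set f := lineRestrict x w v
  have hfv (t : ℝ) : MvPolynomial.eval (fun j => (x + t • w) j) v = f.eval t := by
    rw [eval_lineRestrict]; simp
  have hfd (t : ℝ) : ∑ i, w i * MvPolynomial.eval (fun j => (x + t • w) j)
      (MvPolynomial.pderiv i v) = (derivative f).eval t := by
    rw [derivative_lineRestrict, eval_finsetSum]
    simp [eval_lineRestrict]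
  have hshift (t : ℝ) : x + s • w + (t - s) • w = x + t • w := by module
  calc ∫⁻ t : ℝ, A.indicator (fun x => ENNReal.ofReal
          ((∑ i, w i * MvPolynomial.eval (fun j => x j) (MvPolynomial.pderiv i v)) ^ 2)) (x + t • w)
      ≤ ∫⁻ t in Set.Icc (a + s) (b + s), ENNReal.ofReal ((derivative f).eval t ^ 2) := by
        rw [← lintegral_indicator measurableSet_Icc]
        refine lintegral_mono fun t => ?_
        by_cases ht : x + t • w ∈ A
        · obtain ⟨h3, h4⟩ := h1 (t - s) (by rwa [hshift])
          rw [Set.indicator_of_mem ht, Set.indicator_of_mem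
            (show t ∈ Set.Icc (a + s) (b + s) from ⟨by linarith, by linarith⟩), hfd]
        · simp [ht]
    _ = ENNReal.ofReal (∫ t in (a + s)..(b + s), (derivative f).eval t ^ 2) :=
        lintegral_Icc_ofReal (by fun_prop) (fun _ => sq_nonneg _) hle.le
    _ ≤ ENNReal.ofReal (12 * p ^ 4 / l ^ 2 * ∫ t in (a + s)..(b + s), f.eval t ^ 2) := by
        refine ENNReal.ofReal_le_ofReal ((integral_derivative_sq_le
          (natDegree_lineRestrict_le hv x w) hle).trans ?_)
        rw [hle']
        have : 0 ≤ ∫ t in (a + s)..(b + s), f.eval t ^ 2 :=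
          intervalIntegral.integral_nonneg hle.le fun _ _ => sq_nonneg _
        gcongr
    _ = ENNReal.ofReal (12 * p ^ 4 / l ^ 2) *
          ∫⁻ t in Set.Icc (a + s) (b + s), ENNReal.ofReal (f.eval t ^ 2) := by
        rw [ENNReal.ofReal_mul hC,
          lintegral_Icc_ofReal (by fun_prop) (fun _ => sq_nonneg _) hle.le]
    _ ≤ _ := by
        refine mul_le_mul_right ?_ _
        rw [← lintegral_indicator measurableSet_Icc]
        refine lintegral_mono fun t => ?_
        by_cases ht : t ∈ Set.Icc (a + s) (b + s)
        · have := h2 (t - s) ⟨by linarith [ht.1], by linarith [ht.2]⟩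
          rw [hshift] at this
          rw [Set.indicator_of_mem ht, Set.indicator_of_mem this, hfv]
        · simp [ht]

end

theorem one_le_rhat (m : ℕ) (φ : (Fin m → ℝ) → ℝ) : (1 : ℝ) ≤ rhat m φ := by
  exact_mod_cast Nat.le_add_left 1 _

namespace IsRefGenPrism

variable {m : ℕ} {φ : (Fin m → ℝ) → ℝ}

theorem continuous (hφ : IsRefGenPrism m φ) : Continuous φ :=
  let ⟨_, hL⟩ := hφ.1
  hL.continuous

theorem one_le (hφ : IsRefGenPrism m φ) {y : Fin m → ℝ} (hy : y ∈ unitCube m) : 1 ≤ φ y := by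
  have h : WithLp.toLp 2 (Fin.snoc y 1 : Fin (m + 1) → ℝ) ∈ prism m φ := by
    refine hφ.2.1 fun i => ?_
    refine Fin.lastCases ?_ (fun j => ?_) i
    · simp
    · simpa using hy j
  simpa using h.2.2

theorem lt_rhat (hφ : IsRefGenPrism m φ) {y : Fin m → ℝ} (hy : y ∈ unitCube m) :
    φ y < rhat m φ := by
  have hc : IsCompact (unitCube m) := by
    have := isCompact_univ_pi fun _ : Fin m => isCompact_Icc (a := (0 : ℝ)) (b := 1)
    simpa [unitCube, Set.pi] using this
  have hle : φ y ≤ sSup (φ '' unitCube m) :=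
    le_csSup (hc.image hφ.continuous).bddAbove (Set.mem_image_of_mem φ hy)
  unfold rhat
  push_cast
  exact hle.trans_lt (Nat.lt_floor_add_one _)

theorem isCompact_prism (hφ : IsRefGenPrism m φ) : IsCompact (prism m φ) := by
  have hc : IsCompact ((WithLp.toLp 2 : (Fin (m + 1) → ℝ) → EuclideanSpace ℝ (Fin (m + 1))) ''
      Set.univ.pi fun _ => Set.Icc (0 : ℝ) (rhat m φ)) :=
    (isCompact_univ_pi fun _ => isCompact_Icc).image (PiLp.continuous_toLp 2 _)
  have hr := one_le_rhat m φ
  refine hc.of_isClosed_subset ?_ ?_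
  · have := hφ.continuous
    simp only [prism, Set.mem_Icc, Set.ofPred_and, Set.ofPred_forall]
    refine ((isClosed_iInter fun i => ?_).inter ?_)
    · exact (isClosed_le (by fun_prop) (by fun_prop)).inter
        (isClosed_le (by fun_prop) (by fun_prop))
    · exact (isClosed_le (by fun_prop) (by fun_prop)).inter
        (isClosed_le (by fun_prop) (by fun_prop))
  · rintro x ⟨hx, hx0, hx1⟩
    refine ⟨x.ofLp, fun i _ => ?_, rfl⟩
    refine Fin.lastCases ?_ (fun j => ?_) i
    · exact ⟨hx0, hx1.trans (hφ.lt_rhat hx).le⟩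
    · exact ⟨(hx j).1, (hx j).2.trans hr⟩

theorem one_sub_mul_le (hφ : IsRefGenPrism m φ) {y y' : Fin m → ℝ} (hy : y ∈ unitCube m)
    (hy' : y' ∈ unitCube m) {s : ℝ} (hs : s ∈ Set.Icc (0 : ℝ) 1) :
    (1 - s) * φ y ≤ φ (fun i => (1 - s) * y i + s * y' i) := by
  have h := hφ.2.2 (WithLp.toLp 2 (Fin.snoc y' 0 : Fin (m + 1) → ℝ))
    ⟨fun i => by simpa using hy' i, by simp⟩
    (WithLp.toLp 2 (Fin.snoc y (φ y) : Fin (m + 1) → ℝ))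
    ⟨fun i => by simpa using hy i, by simp⟩
    ⟨s, 1 - s, hs.1, by linarith [hs.2], by ring, rfl⟩
  have h2 := h.2.2
  simp only [PiLp.add_apply, PiLp.smul_apply, Fin.snoc_last, Fin.snoc_castSucc, smul_eq_mul,
    mul_zero, zero_add] at h2
  simpa only [add_comm] using h2

theorem integral_vertical_derivative_sq_le (hφ : IsRefGenPrism m φ)
    {v : MvPolynomial (Fin (m + 1)) ℝ} {p : ℕ} (hv : v.totalDegree ≤ p) :
    ∫ x in prism m φ,
        (MvPolynomial.eval (fun j => x j) (MvPolynomial.pderiv (Fin.last m) v)) ^ 2 ≤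
      12 * p ^ 4 * ∫ x in prism m φ, (MvPolynomial.eval (fun j => x j) v) ^ 2 := by
  have h := integral_directional_derivative_sq_le hφ.isCompact_prism hφ.isCompact_prism
    (w := EuclideanSpace.single (Fin.last m) 1) (j := Fin.last m) (by simp) one_pos ?_ hv
  · simpa [Pi.single_apply] using h
  · rintro x ⟨hx, hx0, hx1⟩
    have hφx := hφ.one_le hx
    refine ⟨-x (Fin.last m), φ (fun i => x (Fin.castSucc i)) - x (Fin.last m), by linarith, ?_, ?_⟩
    · rintro t ⟨-, ht0, ht1⟩
      simp [(Fin.castSucc_lt_last _).ne] at ht0 ht1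
      constructor <;> linarith
    · rintro t ⟨ht0, ht1⟩
      refine ⟨fun i => ?_, ?_, ?_⟩
      · simpa [(Fin.castSucc_lt_last _).ne] using hx i
      · simp; linarith
      · simp [(Fin.castSucc_lt_last _).ne]; linarith

theorem integral_horizontal_derivative_sq_le (hφ : IsRefGenPrism m φ)
    {v : MvPolynomial (Fin (m + 1)) ℝ} {p : ℕ} (hv : v.totalDegree ≤ p) (i : Fin m) :
    ∫ x in prism m φ ∩ {x | x (Fin.last m) ≤ 1},
        (MvPolynomial.eval (fun j => x j) (MvPolynomial.pderiv i.castSucc v)) ^ 2 ≤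
      12 * p ^ 4 * ∫ x in prism m φ, (MvPolynomial.eval (fun j => x j) v) ^ 2 := by
  have h := integral_directional_derivative_sq_le
    (A := prism m φ ∩ {x | x (Fin.last m) ≤ 1})
    (hφ.isCompact_prism.inter_right (isClosed_le (by fun_prop) (by fun_prop)))
    hφ.isCompact_prism
    (w := EuclideanSpace.single i.castSucc 1) (j := i.castSucc) (by simp) one_pos ?_ hv
  · simpa [Pi.single_apply] using h
  · rintro x ⟨⟨hx, hx0, -⟩, hx1⟩
    refine ⟨-x i.castSucc, 1 - x i.castSucc, by linarith, ?_, ?_⟩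
    · rintro t ⟨⟨ht, -⟩, -⟩
      have := ht i
      simp at this
      constructor <;> linarith
    · rintro t ⟨ht0, ht1⟩
      refine hφ.2.1 fun k => ?_
      refine Fin.lastCases ?_ (fun j => ?_) k
      · simpa [(Fin.castSucc_lt_last _).ne'] using ⟨hx0, hx1⟩
      · by_cases hj : j = i
        · subst hj
          simp
          constructor <;> linarith
        · simpa [hj] using hx j

/-- The direction `ε e_i - c e_d`, descending towards the flat base. -/
noncomputable def descent (m : ℕ) (i : Fin m) (ε c : ℝ) : EuclideanSpace ℝ (Fin (m + 1)) :=
  EuclideanSpace.single i.castSucc ε - EuclideanSpace.single (Fin.last m) c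

/-- The points of the prism above height `1` in the half from which the direction
`ε e_i` points inwards. -/
def upperHalf (m : ℕ) (φ : (Fin m → ℝ) → ℝ) (i : Fin m) (ε : ℝ) :
    Set (EuclideanSpace ℝ (Fin (m + 1))) :=
  prism m φ ∩ {x | 1 ≤ x (Fin.last m) ∧ ε * (x i.castSucc - 1 / 2) ≤ 0}

theorem isCompact_upperHalf (hφ : IsRefGenPrism m φ) (i : Fin m) (ε : ℝ) :
    IsCompact (upperHalf m φ i ε) := by
  refine hφ.isCompact_prism.inter_right ?_
  rw [Set.ofPred_and]
  exact (isClosed_le (by fun_prop) (by fun_prop)).inter (isClosed_le (by fun_prop) (by fun_prop))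

theorem add_smul_descent_mem_prism (hφ : IsRefGenPrism m φ) {i : Fin m} {ε c : ℝ}
    (hε : ε = 1 ∨ ε = -1) (hc : 2 * rhat m φ ≤ c) {z : EuclideanSpace ℝ (Fin (m + 1))}
    (hz : z ∈ upperHalf m φ i ε) {s : ℝ} (hs : s ∈ Set.Icc 0 (z (Fin.last m) / c)) :
    z + s • descent m i ε c ∈ prism m φ := by
  obtain ⟨⟨hzc, hz0, hzφ⟩, hz1, hzi⟩ := hz
  set y : Fin m → ℝ := fun k => z k.castSucc with hy
  have hyc : y ∈ unitCube m := hzc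
  have hφ1 := hφ.one_le hyc
  have hφr := hφ.lt_rhat hyc
  have hc0 : 0 < c := by linarith
  have hsc : s * c ≤ z (Fin.last m) := (le_div_iff₀ hc0).1 hs.2
  have hqc : φ y / c ≤ 1 / 2 := by rw [div_le_iff₀ hc0]; linarith
  have hq0 : 0 ≤ φ y / c := by positivity
  have hsq : s ≤ φ y / c := hs.2.trans (by gcongr)
  have hcube (q : ℝ) (hq : q ∈ Set.Icc 0 (φ y / c)) :
      (fun k => y k + q * if k = i then ε else 0) ∈ unitCube m := by
    intro k
    by_cases hk : k = i
    · subst hk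
      have h1 : y k ∈ Set.Icc (0 : ℝ) 1 := hyc k
      change ε * (y k - 1 / 2) ≤ 0 at hzi
      simp only [if_true]
      rcases hε with rfl | rfl <;> constructor <;> linarith [h1.1, h1.2, hq.1, hq.2]
    · simpa [hk] using hyc k
  have hcoord : (fun k : Fin m => (z + s • descent m i ε c) k.castSucc) =
      fun k => y k + s * if k = i then ε else 0 := by
    funext k
    simp [descent, hy, (Fin.castSucc_lt_last k).ne]
  have hlast : (z + s • descent m i ε c) (Fin.last m) = z (Fin.last m) - s * c := by
    simp [descent, (Fin.castSucc_lt_last i).ne']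
    ring
  have hcone := hφ.one_sub_mul_le hyc (hcube (φ y / c) ⟨hq0, le_rfl⟩) (s := s * c / φ y)
    ⟨by have := hs.1; positivity, by rw [div_le_one (by linarith)]; linarith⟩
  have hcomb : (fun k => (1 - s * c / φ y) * y k +
      s * c / φ y * (y k + φ y / c * if k = i then ε else 0)) =
      fun k => y k + s * if k = i then ε else 0 := by
    funext k
    have : φ y ≠ 0 := by positivity
    field_simp
    ring
  rw [hcomb, sub_mul, one_mul, div_mul_cancel₀ _ (by positivity)] at hcone
  refine ⟨fun k => ?_, ?_⟩
  · have := hcube s ⟨hs.1, hsq⟩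
    rw [← hcoord] at this
    exact this k
  · rw [hcoord, hlast]
    constructor <;> linarith

theorem integral_descent_derivative_sq_le (hφ : IsRefGenPrism m φ)
    {v : MvPolynomial (Fin (m + 1)) ℝ} {p : ℕ} (hv : v.totalDegree ≤ p) (i : Fin m) {ε c : ℝ}
    (hε : ε = 1 ∨ ε = -1) (hc : 2 * rhat m φ ≤ c) (hc0 : 0 < c) :
    ∫ x in upperHalf m φ i ε,
        (ε * MvPolynomial.eval (fun j => x j) (MvPolynomial.pderiv i.castSucc v) -
          c * MvPolynomial.eval (fun j => x j) (MvPolynomial.pderiv (Fin.last m) v)) ^ 2 ≤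
      12 * p ^ 4 * c ^ 2 * ∫ x in prism m φ, (MvPolynomial.eval (fun j => x j) v) ^ 2 := by
  have hwi : descent m i ε c i.castSucc = ε := by simp [descent, (Fin.castSucc_lt_last i).ne]
  have h := integral_directional_derivative_sq_le (hφ.isCompact_upperHalf i ε) hφ.isCompact_prism
    (w := descent m i ε c) (j := i.castSucc) (by rwa [hwi]) (one_div_pos.2 hc0) ?_ hv
  · simpa [descent, Pi.single_apply, sub_mul, Finset.sum_sub_distrib] using h
  · intro x hx
    set T : Set ℝ := {t | x + t • descent m i ε c ∈ upperHalf m φ i ε}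
    have hTc : IsClosed T :=
      (hφ.isCompact_upperHalf i ε).isClosed.preimage (by fun_prop)
    have hTb : T ⊆ Set.Icc (-1) 1 := by
      intro t ht
      have h1 := hx.1.1 i
      have h2 := ht.1.1 i
      rw [PiLp.add_apply, PiLp.smul_apply, hwi, smul_eq_mul] at h2
      rcases hε with rfl | rfl <;> constructor <;> linarith [h1.1, h1.2, h2.1, h2.2]
    obtain ⟨a, haT, ha⟩ := (isCompact_Icc.of_isClosed_subset hTc hTb).exists_isLeast
      ⟨0, by simpa [T] using hx⟩
    have hlast (t : ℝ) : (x + t • descent m i ε c) (Fin.last m) = x (Fin.last m) - t * c := by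
      simp [descent, (Fin.castSucc_lt_last i).ne']
      ring
    have haz := haT.2.1
    refine ⟨a, a + (x + a • descent m i ε c) (Fin.last m) / c, ?_, fun t ht => ⟨ha ht, ?_⟩, ?_⟩
    · rw [add_sub_cancel_left]
      gcongr
    · have := ht.2.1
      rw [hlast] at this ⊢
      rw [← sub_le_iff_le_add', le_div_iff₀ hc0]
      linarith
    · rintro t ⟨hat, htb⟩
      have := hφ.add_smul_descent_mem_prism hε hc haT (s := t - a)
        ⟨by linarith, by linarith⟩
      rwa [show x + a • descent m i ε c + (t - a) • descent m i ε c =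
        x + t • descent m i ε c by module] at this

theorem integral_upperHalf_derivative_sq_le (hφ : IsRefGenPrism m φ)
    {v : MvPolynomial (Fin (m + 1)) ℝ} {p : ℕ} (hv : v.totalDegree ≤ p) (i : Fin m) {ε : ℝ}
    (hε : ε = 1 ∨ ε = -1) :
    ∫ x in upperHalf m φ i ε,
        (MvPolynomial.eval (fun j => x j) (MvPolynomial.pderiv i.castSucc v)) ^ 2 ≤
      192 * p ^ 4 * rhat m φ ^ 2 *
        ∫ x in prism m φ, (MvPolynomial.eval (fun j => x j) v) ^ 2 := by
  have hr : (0 : ℝ) < rhat m φ := zero_lt_one.trans_le (one_le_rhat m φ)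
  have hInt {g : EuclideanSpace ℝ (Fin (m + 1)) → ℝ} (hg : Continuous g) :
      IntegrableOn g (upperHalf m φ i ε) :=
    hg.continuousOn.integrableOn_compact (hφ.isCompact_upperHalf i ε)
  have hdi := continuous_eval_mvPolynomial (MvPolynomial.pderiv i.castSucc v)
  have hdl := continuous_eval_mvPolynomial (MvPolynomial.pderiv (Fin.last m) v)
  set c : ℝ := 2 * rhat m φ with hcdef
  have h1 := hφ.integral_descent_derivative_sq_le hv i hε hcdef.ge (by positivity)
  have h2 : ∫ x in upperHalf m φ i ε,
      (MvPolynomial.eval (fun j => x j) (MvPolynomial.pderiv (Fin.last m) v)) ^ 2 ≤ _ :=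
    (setIntegral_mono_set ((hdl.pow 2).continuousOn.integrableOn_compact hφ.isCompact_prism)
      (Filter.Eventually.of_forall fun _ => sq_nonneg _)
      (Set.inter_subset_left.eventuallyLE)).trans (hφ.integral_vertical_derivative_sq_le hv)
  have h3 : ∫ x in upperHalf m φ i ε,
      (MvPolynomial.eval (fun j => x j) (MvPolynomial.pderiv i.castSucc v)) ^ 2 ≤
      ∫ x in upperHalf m φ i ε,
        (2 * (ε * MvPolynomial.eval (fun j => x j) (MvPolynomial.pderiv i.castSucc v) -
          c * MvPolynomial.eval (fun j => x j) (MvPolynomial.pderiv (Fin.last m) v)) ^ 2 +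
        2 * c ^ 2 *
          (MvPolynomial.eval (fun j => x j) (MvPolynomial.pderiv (Fin.last m) v)) ^ 2) := by
    refine integral_mono (hInt (by fun_prop)) (hInt (by fun_prop)) fun x => ?_
    have hε2 : ε ^ 2 = 1 := by rcases hε with rfl | rfl <;> norm_num
    dsimp only
    generalize MvPolynomial.eval (fun j => x j) (MvPolynomial.pderiv i.castSucc v) = A
    generalize MvPolynomial.eval (fun j => x j) (MvPolynomial.pderiv (Fin.last m) v) = B
    have : A ^ 2 = (ε * A) ^ 2 := by rw [mul_pow, hε2, one_mul]
    rw [this]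
    nlinarith [sq_nonneg (ε * A - 2 * (c * B))]
  rw [integral_add (hInt (by fun_prop)) (hInt (by fun_prop)), integral_const_mul,
    integral_const_mul] at h3
  have h4 := mul_le_mul_of_nonneg_left h2 (by positivity : 0 ≤ 2 * c ^ 2)
  calc _ ≤ _ := h3
    _ ≤ 48 * p ^ 4 * c ^ 2 *
        ∫ x in prism m φ, (MvPolynomial.eval (fun j => x j) v) ^ 2 := by linarith
    _ = _ := by rw [hcdef]; ring

theorem integral_pderiv_castSucc_sq_le (hφ : IsRefGenPrism m φ)
    {v : MvPolynomial (Fin (m + 1)) ℝ} {p : ℕ} (hv : v.totalDegree ≤ p) (i : Fin m) :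
    ∫ x in prism m φ,
        (MvPolynomial.eval (fun j => x j) (MvPolynomial.pderiv i.castSucc v)) ^ 2 ≤
      (384 * rhat m φ ^ 2 + 12) * p ^ 4 *
        ∫ x in prism m φ, (MvPolynomial.eval (fun j => x j) v) ^ 2 := by
  set g : EuclideanSpace ℝ (Fin (m + 1)) → ℝ := fun x =>
    (MvPolynomial.eval (fun j => x j) (MvPolynomial.pderiv i.castSucc v)) ^ 2
  have hg0 (x) : 0 ≤ g x := sq_nonneg _
  have hg : IntegrableOn g (prism m φ) :=
    ((continuous_eval_mvPolynomial _).pow 2).continuousOn.integrableOn_compact hφ.isCompact_prism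
  set L : Set (EuclideanSpace ℝ (Fin (m + 1))) := {x | x (Fin.last m) ≤ 1}
  set H : Set (EuclideanSpace ℝ (Fin (m + 1))) := {x | x i.castSucc ≤ 1 / 2}
  have hL : MeasurableSet L := (isClosed_le (by fun_prop) (by fun_prop)).measurableSet
  have hH : MeasurableSet H := (isClosed_le (by fun_prop) (by fun_prop)).measurableSet
  have hmono {s t : Set (EuclideanSpace ℝ (Fin (m + 1)))} (hst : s ⊆ t) (ht : t ⊆ prism m φ) :
      ∫ x in s, g x ≤ ∫ x in t, g x :=
    setIntegral_mono_set (hg.mono_set ht) (Filter.Eventually.of_forall hg0) hst.eventuallyLE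
  have hp : ∫ x in (prism m φ \ L) ∩ H, g x ≤ ∫ x in upperHalf m φ i 1, g x := by
    refine hmono ?_ Set.inter_subset_left
    rintro x ⟨⟨hx, hxL⟩, hxH⟩
    have h1 : 1 < x (Fin.last m) := not_le.1 hxL
    have h2 : x i.castSucc ≤ 1 / 2 := hxH
    exact ⟨hx, h1.le, by linarith⟩
  have hn : ∫ x in (prism m φ \ L) \ H, g x ≤ ∫ x in upperHalf m φ i (-1), g x := by
    refine hmono ?_ Set.inter_subset_left
    rintro x ⟨⟨hx, hxL⟩, hxH⟩
    have h1 : 1 < x (Fin.last m) := not_le.1 hxL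
    have h2 : 1 / 2 < x i.castSucc := not_le.1 hxH
    exact ⟨hx, h1.le, by linarith⟩
  have e1 := integral_inter_add_sdiff hL hg
  have e2 := integral_inter_add_sdiff hH (hg.mono_set (Set.sdiff_subset (t := L)))
  have h0 : ∫ x in prism m φ ∩ L, g x ≤ _ := hφ.integral_horizontal_derivative_sq_le hv i
  have h1 : ∫ x in upperHalf m φ i 1, g x ≤ _ :=
    hφ.integral_upperHalf_derivative_sq_le hv i (Or.inl rfl)
  have h2 : ∫ x in upperHalf m φ i (-1), g x ≤ _ :=
    hφ.integral_upperHalf_derivative_sq_le hv i (Or.inr rfl)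
  linarith

end IsRefGenPrism

/-- **`H¹–L₂` inverse estimate on a reference generalized prism** (Lemma `basic_H1_L2`).
For every reference generalized prism `K̂ = K̂_φ ⊂ ℝ^d` (`d = m+1 ≥ 2`) with parameter `r̂`,
and every real polynomial `v` of total degree at most `p` in `d` variables,
`∫_{K̂} |∇v|² ≤ C_inv^B(d, r̂) · p⁴ · ∫_{K̂} v²`. -/
theorem H1_L2_inverse_estimate_prism
    (m p : ℕ) (hm : 1 ≤ m)
    (φ : (Fin m → ℝ) → ℝ) (hφ : IsRefGenPrism m φ)
    (v : MvPolynomial (Fin (m + 1)) ℝ) (hv : v.totalDegree ≤ p) :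
    ∫ x in prism m φ,
        (∑ i : Fin (m + 1), (MvPolynomial.eval (fun j => x j) (MvPolynomial.pderiv i v)) ^ 2) ≤
      CinvB (m + 1) (rhat m φ) * (p : ℝ) ^ 4 *
        ∫ x in prism m φ, (MvPolynomial.eval (fun j => x j) v) ^ 2 := by
  have hr := one_le_rhat m φ
  have hV : 0 ≤ ∫ x in prism m φ, (MvPolynomial.eval (fun j => x j) v) ^ 2 :=
    integral_nonneg fun _ => sq_nonneg _
  have hInt (i : Fin (m + 1)) : IntegrableOn (fun x : EuclideanSpace ℝ (Fin (m + 1)) =>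
      (MvPolynomial.eval (fun j => x j) (MvPolynomial.pderiv i v)) ^ 2) (prism m φ) :=
    ((continuous_eval_mvPolynomial _).pow 2).continuousOn.integrableOn_compact hφ.isCompact_prism
  rw [integral_finsetSum _ fun i _ => hInt i, Fin.sum_univ_castSucc]
  set V := ∫ x in prism m φ, (MvPolynomial.eval (fun j => x j) v) ^ 2
  set r : ℝ := (rhat m φ : ℝ)
  calc _ ≤ (∑ _i : Fin m, (384 * r ^ 2 + 12) * (p : ℝ) ^ 4 * V) + 12 * p ^ 4 * V :=
        add_le_add (Finset.sum_le_sum fun i _ => hφ.integral_pderiv_castSucc_sq_le hv i)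
          (hφ.integral_vertical_derivative_sq_le hv)
    _ = (m * (384 * r ^ 2) + 12 * (m + 1)) * (p : ℝ) ^ 4 * V := by
        rw [Finset.sum_const, Finset.card_univ, Fintype.card_fin, nsmul_eq_mul]
        ring
    _ ≤ (m * (64 * r * (r + 1) * (2 * r + 1)) + 12 * (m + 1)) * (p : ℝ) ^ 4 * V := by
        have : 384 * r ^ 2 ≤ 64 * r * (r + 1) * (2 * r + 1) := by
          nlinarith [mul_nonneg (mul_nonneg (zero_le_one.trans hr) (sub_nonneg.2 hr))
            (by linarith : 0 ≤ 2 * r - 1)]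
        gcongr ((m : ℝ) * ?_ + _) * _ * _
    _ = _ := by
        unfold CinvB
        push_cast
        ring
end

section
/- Let K̂ ⊂ ℝ^d be a reference generalized prism and, for ε > 0, define K̂_ε := K̂ ∩ (K̂ − ε e_d), where A − z := {x − z : x ∈ A} and e_d is the d-th standard basis vector. Then for every p ≥ 1, every real polynomial v of total degree at most p in d variables, and every 0 < ε ≤ (8p)^{−2}, (1/2) ∫_{K̂} v² dx ≤ ∫_{K̂_ε} v² dx. -/
open MeasureTheory

/-- The vertically shifted intersection `K̂_ε := K̂ ∩ (K̂ - ε e_d)`, where `e_d` is the `d`-th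
standard basis vector: `x ∈ K̂_ε ↔ x ∈ K̂ ∧ x + ε e_d ∈ K̂`. -/
def prismShift (m : ℕ) (φ : (Fin m → ℝ) → ℝ) (ε : ℝ) : Set (EuclideanSpace ℝ (Fin (m + 1))) :=
  {x | x ∈ prism m φ ∧ x + ε • (EuclideanSpace.single (Fin.last m) (1 : ℝ)) ∈ prism m φ}

open Polynomial in
/-- The coefficients are the zeroth column of the inverse of the Hilbert matrix of size `p + 1`. -/
theorem exists_hilbert_inverse_column (p : ℕ) :
    ∃ c : ℕ → ℝ, c 0 = ((p : ℝ) + 1) ^ 2 ∧ ∀ j ≤ p,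
      ∑ i ∈ Finset.range (p + 1), c i / ((i : ℝ) + j + 1) = if j = 0 then 1 else 0 := by
  set node : ℕ → ℝ := fun i => -((i : ℝ) + 1) with hnode
  set s := Finset.range (p + 1)
  set f : ℝ[X] := Lagrange.nodal (Finset.range p) (fun j : ℕ => (j : ℝ) + 1)
  have hinj : Set.InjOn node s := fun a _ b _ h => by simpa [hnode] using h
  have hdeg : f.degree < s.card := by
    simp only [f, s, Lagrange.degree_nodal, Finset.card_range]
    exact_mod_cast Nat.lt_succ_self p
  have hfac : ∏ j ∈ Finset.range p, ((j : ℝ) + 1) = p.factorial := by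
    exact_mod_cast congrArg (Nat.cast : ℕ → ℝ) (Finset.prod_range_add_one_eq_factorial p)
  have hfac' : ∏ j ∈ s, ((j : ℝ) + 1) = (p + 1).factorial := by
    exact_mod_cast congrArg (Nat.cast : ℕ → ℝ) (Finset.prod_range_add_one_eq_factorial (p + 1))
  have hp0 : (p.factorial : ℝ) ≠ 0 := by exact_mod_cast p.factorial_ne_zero
  have hsgn : ((-1 : ℝ) ^ p) * (-1) ^ p = 1 := by rw [← mul_pow]; simp
  have key : ∀ j : ℕ, f.eval (j : ℝ) = (∏ i ∈ s, ((i : ℝ) + j + 1)) *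
      ∑ i ∈ s, Lagrange.nodalWeight s node i * f.eval (node i) / ((i : ℝ) + j + 1) := by
    intro j
    have hne : ∀ i ∈ s, (j : ℝ) ≠ node i := by
      intro i _
      simp only [hnode]
      have : (0 : ℝ) ≤ i := i.cast_nonneg
      have : (0 : ℝ) ≤ j := j.cast_nonneg
      linarith
    conv_lhs => rw [Lagrange.eq_interpolate hinj hdeg,
      Lagrange.eval_interpolate_not_at_node _ hne, Lagrange.eval_nodal]
    congr 1
    · refine Finset.prod_congr rfl fun i _ => ?_
      simp only [hnode]; ring
    · refine Finset.sum_congr rfl fun i _ => ?_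
      rw [show (j : ℝ) - node i = (i : ℝ) + j + 1 by simp only [hnode]; ring, div_eq_mul_inv]
      ring
  refine ⟨fun i => ((-1) ^ p * ((p : ℝ) + 1)) *
    (Lagrange.nodalWeight s node i * f.eval (node i)), ?_, ?_⟩
  · have hw : Lagrange.nodalWeight s node 0 = (p.factorial : ℝ)⁻¹ := by
      have he : s.erase 0 = (Finset.range p).map ⟨Nat.succ, Nat.succ_injective⟩ := by
        ext i
        rcases i with _ | i <;> simp [s]
      rw [Lagrange.nodalWeight, he, Finset.prod_map, Finset.prod_inv_distrib, ← hfac]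
      congr 1
      refine Finset.prod_congr rfl fun i _ => ?_
      simp [hnode]
    have hf : f.eval (node 0) = (-1) ^ p * ((p : ℝ) + 1) * p.factorial := by
      have h1 : ∏ j ∈ Finset.range p, ((j : ℝ) + 1 + 1) = ((p : ℝ) + 1) * p.factorial := by
        have := hfac'
        rw [Finset.prod_range_succ'] at this
        simpa [Nat.factorial_succ] using this
      rw [Lagrange.eval_nodal, mul_assoc, ← h1]
      simp_rw [show ∀ j : ℕ, node 0 - ((j : ℝ) + 1) = (-1) * ((j : ℝ) + 1 + 1) from
        fun j => by simp only [hnode]; push_cast; ring]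
      rw [Finset.prod_mul_distrib]; simp
    simp only [hw, hf]
    field_simp
    linear_combination hsgn
  · intro j hj
    have hpos : (∏ i ∈ s, ((i : ℝ) + j + 1)) ≠ 0 :=
      Finset.prod_ne_zero_iff.2 fun i _ => by positivity
    have hk := key j
    simp_rw [mul_div_assoc _ _ ((_ : ℝ) + j + 1)] at hk ⊢
    rw [← Finset.mul_sum]
    rcases j with _ | j
    · have h0 : f.eval ((0 : ℕ) : ℝ) = (-1) ^ p * p.factorial := by
        rw [Lagrange.eval_nodal, ← hfac]
        simp_rw [show ∀ j : ℕ, ((0 : ℕ) : ℝ) - ((j : ℝ) + 1) = (-1) * ((j : ℝ) + 1) from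
          fun j => by push_cast; ring]
        rw [Finset.prod_mul_distrib]; simp
      rw [h0] at hk
      simp only [Nat.cast_zero, add_zero] at hk ⊢
      rw [hfac', Nat.factorial_succ] at hk
      push_cast at hk
      set S := ∑ i ∈ s, Lagrange.nodalWeight s node i * (eval (node i) f / ((i : ℝ) + 1))
      have : (-1) ^ p = ((p : ℝ) + 1) * S := mul_right_cancel₀ hp0 (by linear_combination hk)
      simp only [if_true]
      linear_combination (-1) ^ p * (-this) + hsgn
    · have h0 : f.eval ((j + 1 : ℕ) : ℝ) = 0 := by
        rw [Lagrange.eval_nodal]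
        exact Finset.prod_eq_zero (Finset.mem_range.2 (Nat.lt_of_succ_le hj)) (by push_cast; ring)
      rw [h0] at hk
      rcases mul_eq_zero.1 hk.symm with h | h
      · exact absurd h hpos
      · rw [h]; simp

open Polynomial in
/-- Sharp endpoint evaluation bound on the unit interval. -/
theorem sq_eval_zero_le (p : ℕ) (q : ℝ[X]) (hq : q.natDegree ≤ p) :
    q.eval 0 ^ 2 ≤ ((p : ℝ) + 1) ^ 2 * ∫ t in (0 : ℝ)..1, q.eval t ^ 2 := by
  obtain ⟨c, hc0, hc⟩ := exists_hilbert_inverse_column p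
  set K : ℝ[X] := ∑ i ∈ Finset.range (p + 1), C (c i) * X ^ i with hK
  have hcoeff : ∀ n, K.coeff n = if n < p + 1 then c n else 0 := by
    intro n; simp [hK, coeff_C_mul, coeff_X_pow]
  have hKdeg : K.natDegree ≤ p := by
    rw [natDegree_le_iff_coeff_eq_zero]
    intro n hn
    rw [hcoeff, if_neg (by omega)]
  have hrep : ∀ r : ℝ[X], r.natDegree ≤ p →
      ∫ t in (0 : ℝ)..1, K.eval t * r.eval t = r.eval 0 := by
    intro r hr
    have h1 : ∀ t : ℝ, K.eval t * r.eval t = ∑ j ∈ Finset.range (p + 1),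
        ∑ i ∈ Finset.range (p + 1), r.coeff j * c i * t ^ (i + j) := by
      intro t
      rw [eval_eq_sum_range' (Nat.lt_succ_of_le hr), hK, eval_finsetSum, Finset.sum_mul_sum,
        Finset.sum_comm]
      refine Finset.sum_congr rfl fun j _ => Finset.sum_congr rfl fun i _ => ?_
      simp only [eval_mul, eval_C, eval_pow, eval_X]
      ring
    simp_rw [h1]
    rw [intervalIntegral.integral_finsetSum fun j _ =>
      (by fun_prop : Continuous _).intervalIntegrable _ _]
    have h2 : ∀ j ∈ Finset.range (p + 1), ∫ t in (0 : ℝ)..1,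
        ∑ i ∈ Finset.range (p + 1), r.coeff j * c i * t ^ (i + j) =
        r.coeff j * if j = 0 then 1 else 0 := by
      intro j hj
      rw [intervalIntegral.integral_finsetSum fun i _ =>
        (by fun_prop : Continuous _).intervalIntegrable _ _,
        ← hc j (Nat.lt_succ_iff.1 (Finset.mem_range.1 hj)), Finset.mul_sum]
      refine Finset.sum_congr rfl fun i _ => ?_
      rw [intervalIntegral.integral_const_mul, integral_pow]
      simp
      ring
    rw [Finset.sum_congr rfl h2]
    simp [coeff_zero_eq_eval_zero]
  have hK0 : K.eval 0 = ((p : ℝ) + 1) ^ 2 := by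
    rw [← coeff_zero_eq_eval_zero, hcoeff, if_pos (Nat.succ_pos p), hc0]
  have hN : (0 : ℝ) < ((p : ℝ) + 1) ^ 2 := by positivity
  set N : ℝ := ((p : ℝ) + 1) ^ 2
  have h0 : 0 ≤ ∫ t in (0 : ℝ)..1, (N * q.eval t - q.eval 0 * K.eval t) ^ 2 :=
    intervalIntegral.integral_nonneg zero_le_one fun t _ => sq_nonneg _
  have hexp : ∫ t in (0 : ℝ)..1, (N * q.eval t - q.eval 0 * K.eval t) ^ 2 =
      N ^ 2 * (∫ t in (0 : ℝ)..1, q.eval t ^ 2) - 2 * N * q.eval 0 * q.eval 0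
        + q.eval 0 ^ 2 * N := by
    have : ∀ t : ℝ, (N * q.eval t - q.eval 0 * K.eval t) ^ 2 =
        N ^ 2 * q.eval t ^ 2 - 2 * N * q.eval 0 * (K.eval t * q.eval t)
          + q.eval 0 ^ 2 * (K.eval t * K.eval t) := fun t => by ring
    simp_rw [this]
    rw [intervalIntegral.integral_add, intervalIntegral.integral_sub,
      intervalIntegral.integral_const_mul, intervalIntegral.integral_const_mul,
      intervalIntegral.integral_const_mul, hrep q hq, hrep K hKdeg, hK0]
    all_goals exact (by fun_prop : Continuous _).intervalIntegrable _ _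
  rw [hexp] at h0
  refine le_of_mul_le_mul_left ?_ hN
  linarith

open Polynomial in
/-- Endpoint evaluation bound on `[0, x]`. -/
theorem mul_sq_eval_le (p : ℕ) (q : ℝ[X]) (hq : q.natDegree ≤ p) {x : ℝ} (hx : 0 < x) :
    x * q.eval x ^ 2 ≤ ((p : ℝ) + 1) ^ 2 * ∫ t in (0 : ℝ)..x, q.eval t ^ 2 := by
  have hdeg : (q.comp (C x - C x * X)).natDegree ≤ p := by
    have h1 : (C x - C x * X).natDegree ≤ 1 := by compute_degree
    refine natDegree_comp_le.trans ?_
    nlinarith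
  have h := sq_eval_zero_le p _ hdeg
  simp only [eval_comp, eval_sub, eval_C, eval_mul, eval_X, mul_zero, sub_zero] at h
  rw [intervalIntegral.integral_comp_sub_mul (fun t => q.eval t ^ 2) hx.ne' x] at h
  simp only [mul_one, sub_self, mul_zero, sub_zero, smul_eq_mul] at h
  calc x * q.eval x ^ 2 ≤ x * _ := mul_le_mul_of_nonneg_left h hx.le
    _ = _ := by field_simp

open Polynomial in
/-- Chopping a short end off an interval keeps at least half of the `L²` mass of a polynomial. -/
theorem half_integral_sq_le_integral_chop (p : ℕ) (hp : 1 ≤ p) (q : ℝ[X]) (hq : q.natDegree ≤ p)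
    {H ε : ℝ} (hH : 1 ≤ H) (hε : 0 < ε) (hε' : ε ≤ ((8 * (p : ℝ)) ^ 2)⁻¹) :
    (1 / 2) * ∫ t in (0 : ℝ)..H, q.eval t ^ 2 ≤ ∫ t in (0 : ℝ)..(H - ε), q.eval t ^ 2 := by
  have hint : ∀ a b : ℝ, IntervalIntegrable (fun t => q.eval t ^ 2) volume a b := fun a b =>
    (by fun_prop : Continuous fun t => q.eval t ^ 2).intervalIntegrable a b
  have hp' : (1 : ℝ) ≤ p := by exact_mod_cast hp
  have hεp : ε * (64 * (p : ℝ) ^ 2) ≤ 1 := by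
    have := mul_le_mul_of_nonneg_right hε' (by positivity : 0 ≤ (8 * (p : ℝ)) ^ 2)
    rw [inv_mul_cancel₀ (by positivity)] at this
    linarith
  have hε64 : ε ≤ 1 / 64 := by
    nlinarith [mul_nonneg hε.le (by nlinarith : 0 ≤ (p : ℝ) ^ 2 - 1)]
  set I := ∫ t in (0 : ℝ)..H, q.eval t ^ 2
  have hI : 0 ≤ I := intervalIntegral.integral_nonneg (by linarith) fun t _ => sq_nonneg _
  have hpt : ∀ x ∈ Set.Icc (H - ε) H, q.eval x ^ 2 ≤ 8 * (p : ℝ) ^ 2 * I := by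
    rintro x ⟨hx1, hx2⟩
    have hx : 1 / 2 ≤ x := by linarith
    have h1 := mul_sq_eval_le p q hq (by linarith : 0 < x)
    have h2 : ∫ t in (0 : ℝ)..x, q.eval t ^ 2 ≤ I :=
      intervalIntegral.integral_mono_interval le_rfl (by linarith) hx2
        (Filter.Eventually.of_forall fun t => sq_nonneg _) (hint _ _)
    have h3 : ((p : ℝ) + 1) ^ 2 ≤ 4 * (p : ℝ) ^ 2 := by nlinarith
    have h4 : ((p : ℝ) + 1) ^ 2 * ∫ t in (0 : ℝ)..x, q.eval t ^ 2 ≤ 4 * (p : ℝ) ^ 2 * I :=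
      (mul_le_mul_of_nonneg_left h2 (by positivity)).trans (mul_le_mul_of_nonneg_right h3 hI)
    nlinarith [sq_nonneg (q.eval x)]
  have hend : ∫ t in (H - ε)..H, q.eval t ^ 2 ≤ ε * (8 * (p : ℝ) ^ 2 * I) := by
    have := intervalIntegral.integral_mono_on (by linarith : H - ε ≤ H) (hint _ _)
      intervalIntegrable_const hpt
    simpa [mul_left_comm] using this
  have hsplit := intervalIntegral.integral_add_adjacent_intervals (hint 0 (H - ε)) (hint (H - ε) H)
  nlinarith [mul_le_mul_of_nonneg_right hεp hI]

/-- Splitting off the last coordinate of Euclidean space. -/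
def euclideanLastEquiv (m : ℕ) : EuclideanSpace ℝ (Fin (m + 1)) ≃ᵐ ℝ × (Fin m → ℝ) :=
  (MeasurableEquiv.toLp 2 (Fin (m + 1) → ℝ)).symm.trans
    (MeasurableEquiv.piFinSuccAbove (fun _ => ℝ) (Fin.last m))

theorem measurePreserving_euclideanLastEquiv (m : ℕ) :
    MeasurePreserving (euclideanLastEquiv m) :=
  (EuclideanSpace.volume_preserving_symm_measurableEquiv_toLp _).trans
    (volume_preserving_piFinSuccAbove (fun _ : Fin (m + 1) => ℝ) (Fin.last m))

theorem euclideanLastEquiv_symm_apply (m : ℕ) (t : ℝ) (y : Fin m → ℝ) :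
    (euclideanLastEquiv m).symm (t, y) =
      WithLp.toLp 2 (Fin.snoc y t : Fin (m + 1) → ℝ) := by
  rw [← Fin.insertNth_last']; rfl

theorem toLp_snoc_mem_prism {m : ℕ} {ψ : (Fin m → ℝ) → ℝ} {t : ℝ} {y : Fin m → ℝ} :
    WithLp.toLp 2 (Fin.snoc y t : Fin (m + 1) → ℝ) ∈ prism m ψ ↔
      y ∈ unitCube m ∧ t ∈ Set.Icc 0 (ψ y) := by
  simp [prism, unitCube]

theorem isCompact_unitCube (m : ℕ) : IsCompact (unitCube m) := by
  have : unitCube m = Set.univ.pi fun _ => Set.Icc (0 : ℝ) 1 := by ext; simp [unitCube, Pi.le_def, forall_and]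
  rw [this]
  exact isCompact_univ_pi fun _ => isCompact_Icc

theorem isCompact_prism {m : ℕ} {ψ : (Fin m → ℝ) → ℝ} (hψ : Continuous ψ) :
    IsCompact (prism m ψ) := by
  obtain ⟨M, hM⟩ := (isCompact_unitCube m).bddAbove_image hψ.continuousOn
  have hK : IsCompact ((fun z : (Fin m → ℝ) × ℝ =>
      WithLp.toLp 2 (Fin.snoc z.1 z.2 : Fin (m + 1) → ℝ)) ''
        ((unitCube m ×ˢ Set.Icc 0 M) ∩ {z | z.2 ≤ ψ z.1})) := by
    refine IsCompact.image ?_ ?_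
    · exact ((isCompact_unitCube m).prod isCompact_Icc).inter_right
        (isClosed_le continuous_snd (hψ.comp continuous_fst))
    · fun_prop
  convert hK using 1
  ext x
  constructor
  · intro hx
    have hx' : WithLp.toLp 2 (Fin.snoc (fun i : Fin m => x (Fin.castSucc i)) (x (Fin.last m)) :
        Fin (m + 1) → ℝ) = x := by
      ext j
      refine Fin.lastCases ?_ (fun i => ?_) j <;> simp
    refine ⟨(fun i => x (Fin.castSucc i), x (Fin.last m)),
      ⟨⟨hx.1, hx.2.1, hx.2.2.trans (hM ⟨_, hx.1, rfl⟩)⟩, hx.2.2⟩, hx'⟩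
  · rintro ⟨⟨y, t⟩, ⟨⟨hy, ht⟩, hty⟩, rfl⟩
    exact toLp_snoc_mem_prism.2 ⟨hy, ht.1, hty⟩

/-- Fubini's theorem on a generalized prism. -/
theorem integral_prism {m : ℕ} {ψ : (Fin m → ℝ) → ℝ} (hψ : Continuous ψ)
    (hψ0 : ∀ y ∈ unitCube m, 0 ≤ ψ y) {g : EuclideanSpace ℝ (Fin (m + 1)) → ℝ}
    (hg : Continuous g) :
    IntegrableOn (fun y => ∫ t in (0 : ℝ)..ψ y,
      g (WithLp.toLp 2 (Fin.snoc y t : Fin (m + 1) → ℝ))) (unitCube m) ∧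
    ∫ x in prism m ψ, g x = ∫ y in unitCube m, ∫ t in (0 : ℝ)..ψ y,
      g (WithLp.toLp 2 (Fin.snoc y t : Fin (m + 1) → ℝ)) := by
  have hmp := (measurePreserving_euclideanLastEquiv m).symm
  have hemb := (euclideanLastEquiv m).symm.measurableEmbedding
  have hcpt := isCompact_prism hψ
  have hms : MeasurableSet ((euclideanLastEquiv m).symm ⁻¹' prism m ψ) :=
    (euclideanLastEquiv m).symm.measurable hcpt.measurableSet
  have hcube := (isCompact_unitCube m).measurableSet
  have hint : Integrable (((euclideanLastEquiv m).symm ⁻¹' prism m ψ).indicator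
      (g ∘ (euclideanLastEquiv m).symm)) ((volume : Measure ℝ).prod volume) :=
    (integrable_indicator_iff hms).2
      ((hmp.integrableOn_comp_preimage hemb).2 (hg.continuousOn.integrableOn_compact hcpt))
  have hpt : ∀ (t : ℝ) (y : Fin m → ℝ),
      ((euclideanLastEquiv m).symm ⁻¹' prism m ψ).indicator
        (g ∘ (euclideanLastEquiv m).symm) (t, y) =
      (unitCube m).indicator (fun y => (Set.Icc 0 (ψ y)).indicator
        (fun t => g (WithLp.toLp 2 (Fin.snoc y t : Fin (m + 1) → ℝ))) t) y := by
    classical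
    intro t y
    rw [Set.indicator_apply, Set.indicator_apply, Set.indicator_apply, ← ite_and,
      Set.mem_preimage, Function.comp_apply, euclideanLastEquiv_symm_apply]
    simp only [toLp_snoc_mem_prism]
  have hinner : ∀ y : Fin m → ℝ,
      ∫ t, ((euclideanLastEquiv m).symm ⁻¹' prism m ψ).indicator
        (g ∘ (euclideanLastEquiv m).symm) (t, y) =
      (unitCube m).indicator (fun y => ∫ t in (0 : ℝ)..ψ y,
        g (WithLp.toLp 2 (Fin.snoc y t : Fin (m + 1) → ℝ))) y := by
    intro y
    simp_rw [hpt]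
    by_cases hy : y ∈ unitCube m
    · simp_rw [Set.indicator_of_mem hy]
      rw [intervalIntegral.integral_of_le (hψ0 y hy), ← integral_Icc_eq_integral_Ioc,
        integral_indicator measurableSet_Icc]
    · simp [hy]
  constructor
  · rw [← integrable_indicator_iff hcube]
    simpa only [hinner] using hint.integral_prod_right
  · rw [← integral_indicator hcube, ← hmp.setIntegral_preimage_emb hemb]
    simp_rw [← hinner]
    rw [← integral_prod_symm _ hint, ← Measure.volume_eq_prod, integral_indicator hms]
    rfl

/-- Restriction of a polynomial to a vertical line. -/
theorem exists_polynomial_eval_snoc {m p : ℕ} (v : MvPolynomial (Fin (m + 1)) ℝ)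
    (hv : v.totalDegree ≤ p) (y : Fin m → ℝ) :
    ∃ q : Polynomial ℝ, q.natDegree ≤ p ∧
      ∀ t, q.eval t = MvPolynomial.eval (Fin.snoc y t : Fin (m + 1) → ℝ) v := by
  set f : Fin (m + 1) → Polynomial ℝ :=
    Fin.snoc (α := fun _ => Polynomial ℝ) (fun i => Polynomial.C (y i)) Polynomial.X with hf
  refine ⟨MvPolynomial.aeval f v, ?_, fun t => ?_⟩
  · simpa using MvPolynomial.aeval_natDegree_le v hv f (n := 1) fun j => by
      refine Fin.lastCases ?_ (fun i => ?_) j <;> simp [hf]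
  · rw [← Polynomial.coe_evalRingHom, MvPolynomial.aeval_def, MvPolynomial.hom_eval₂,
      MvPolynomial.eval, MvPolynomial.coe_eval₂Hom]
    congr 1
    · ext; simp
    · ext j
      refine Fin.lastCases ?_ (fun i => ?_) j <;> simp [hf]

theorem IsRefGenPrism.one_le_s6 {m : ℕ} {φ : (Fin m → ℝ) → ℝ} (hφ : IsRefGenPrism m φ)
    {y : Fin m → ℝ} (hy : y ∈ unitCube m) : 1 ≤ φ y := by
  have h : WithLp.toLp 2 (Fin.snoc y 1 : Fin (m + 1) → ℝ) ∈ prism m φ := by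
    refine hφ.2.1 fun j => ?_
    refine Fin.lastCases ?_ (fun i => ?_) j
    · simp
    · simpa using hy i
  exact (toLp_snoc_mem_prism.1 h).2.2

theorem prismShift_eq_prism (m : ℕ) (φ : (Fin m → ℝ) → ℝ) {ε : ℝ} (hε : 0 ≤ ε) :
    prismShift m φ ε = prism m fun y => φ y - ε := by
  ext x
  simp only [prismShift, prism, Set.mem_ofPred_eq, Set.mem_Icc, PiLp.add_apply, PiLp.smul_apply,
    PiLp.single_apply, Fin.castSucc_ne_last, if_false, if_true, smul_eq_mul, mul_zero,
    mul_one, add_zero]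
  constructor
  · rintro ⟨⟨h1, h2, h3⟩, h4, h5, h6⟩
    exact ⟨h1, h2, by linarith⟩
  · rintro ⟨h1, h2, h3⟩
    exact ⟨⟨h1, h2, by linarith⟩, h1, by linarith, by linarith⟩

/-- **Stability of polynomial `L₂`-norms under domain perturbation** (Lemma `new_chop`).
For a reference generalized prism `K̂`, `K̂_ε := K̂ ∩ (K̂ - ε e_d)`, every `p ≥ 1`, every real
polynomial `v` of total degree at most `p`, and every `0 < ε ≤ (8p)⁻²`,
`(1/2) ∫_{K̂} v² ≤ ∫_{K̂_ε} v²`. -/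
theorem polynomial_domain_perturbation_stability
    (m p : ℕ) (hm : 1 ≤ m) (hp : 1 ≤ p)
    (φ : (Fin m → ℝ) → ℝ) (hφ : IsRefGenPrism m φ)
    (v : MvPolynomial (Fin (m + 1)) ℝ) (hv : v.totalDegree ≤ p)
    (ε : ℝ) (hε : 0 < ε) (hε' : ε ≤ ((8 * (p : ℝ)) ^ 2)⁻¹) :
    (1 / 2) * ∫ x in prism m φ, (MvPolynomial.eval (fun j => x j) v) ^ 2 ≤
      ∫ x in prismShift m φ ε, (MvPolynomial.eval (fun j => x j) v) ^ 2 := by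
  obtain ⟨L, hL⟩ := hφ.1
  have hp' : (1 : ℝ) ≤ p := by exact_mod_cast hp
  have hε1 : ε ≤ 1 := hε'.trans (inv_le_one_of_one_le₀ (by nlinarith))
  have hg : Continuous fun x : EuclideanSpace ℝ (Fin (m + 1)) =>
      (MvPolynomial.eval (fun j => x j) v) ^ 2 :=
    ((MvPolynomial.continuous_eval v).comp (PiLp.continuous_ofLp 2 _)).pow 2
  obtain ⟨hi₁, he₁⟩ := integral_prism hL.continuous
    (fun y hy => zero_le_one.trans (hφ.one_le_s6 hy)) hg
  obtain ⟨hi₂, he₂⟩ := integral_prism (ψ := fun y => φ y - ε) (hL.continuous.sub continuous_const)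
    (fun y hy => by linarith [hφ.one_le_s6 hy]) hg
  rw [prismShift_eq_prism m φ hε.le, he₁, he₂, ← integral_const_mul]
  refine setIntegral_mono_on (hi₁.const_mul _) hi₂ (isCompact_unitCube m).measurableSet
    fun y hy => ?_
  obtain ⟨q, hq, hqv⟩ := exists_polynomial_eval_snoc v hv y
  simpa only [hqv] using
    half_integral_sq_le_integral_chop p hp q hq (hφ.one_le_s6 hy) hε hε'
end

section
/- There exists a constant C(d) > 0, depending only on the dimension d, with the following property: if K ⊂ ℝ^d is a domain that is star-shaped with respect to a ball B(x, ρ_K) ⊂ K (i.e. for every y ∈ K and z ∈ B(x, ρ_K) the segment [y, z] lies in K), with diameter h_K := diam(K), then for every p ∈ ℕ and every real polynomial v of total degree at most p in d variables, ∫_K |∇v|² dx ≤ C(d) · (h_K/ρ_K)^{d+5} · (p⁴/ρ_K²) · ∫_K v² dx. -/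
open MeasureTheory

open Polynomial Polynomial.Chebyshev in
/-- The derivative at the right end point of `[-1, 1]`, as a functional on polynomials of degree
at most `n`, is a combination of point evaluations with total weight `n ^ 2`. -/
lemma exists_eval_one_derivative_eq_sum_node (n : ℕ) :
    ∃ c : ℕ → ℝ, ∑ i ∈ Finset.range (n + 1), |c i| ≤ (n : ℝ) ^ 2 ∧
      ∀ P : ℝ[X], P.natDegree ≤ n →
        P.derivative.eval 1 = ∑ i ∈ Finset.range (n + 1), c i * P.eval (node n i) := by
  rcases Nat.eq_zero_or_pos n with rfl | hn
  · refine ⟨0, by simp, fun P hP => ?_⟩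
    simp [Polynomial.derivative_of_natDegree_zero (Nat.le_zero.mp hP)]
  let c : ℕ → ℝ := fun i =>
    (∏ j ∈ (Finset.range (n + 1)).erase i, (node n i - node n j))⁻¹ *
      ∑ t ∈ ((Finset.range (n + 1)).erase i).powersetCard (n - 1), ∏ a ∈ t, (1 - node n a)
  have hc : ∀ P : ℝ[X], P.natDegree ≤ n →
      P.derivative.eval 1 = ∑ i ∈ Finset.range (n + 1), c i * P.eval (node n i) := by
    intro P hP
    have hdeg : P.degree < (Finset.range (n + 1)).card := by
      rw [Finset.card_range]
      exact (Polynomial.natDegree_le_iff_degree_le.mp hP).trans_lt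
        (by exact_mod_cast Nat.lt_succ_self n)
    have h := Lagrange.eval_iterate_derivative_eq_sum (strictAntiOn_node n).injOn hdeg
      (k := 1) (by simp [hn]) 1
    simp only [Function.iterate_one, Nat.factorial_one, Nat.cast_one, one_mul,
      Finset.card_range] at h
    rw [h]
    refine Finset.sum_congr rfl fun i _ => ?_
    rw [show n + 1 - (1 + 1) = n - 1 by omega]
    simp only [c]
    ring
  refine ⟨c, ?_, hc⟩
  have habs : ∀ i ∈ Finset.range (n + 1), |c i| = c i * (T ℝ n).eval (node n i) := by
    intro i hi
    have hin : i ≤ n := Nat.lt_succ_iff.mp (Finset.mem_range.mp hi)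
    have hpos : 0 ≤ (-1) ^ i * c i := by
      have h1 : 0 ≤ ∑ t ∈ ((Finset.range (n + 1)).erase i).powersetCard (n - 1),
          ∏ a ∈ t, (1 - node n a) :=
        Finset.sum_nonneg fun t _ => Finset.prod_nonneg fun a _ =>
          sub_nonneg.mpr (node_mem_Icc (n := n) (i := a)).2
      have h2 := inv_nonneg.mpr (zero_lt_prod_node_sub_node hin).le
      rw [mul_inv, ← inv_pow, inv_neg_one] at h2
      simpa only [c, mul_assoc] using mul_nonneg h2 h1
    rw [eval_T_real_node (Finset.mem_Iic.mpr hin), mul_comm, ← abs_of_nonneg hpos]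
    simp [abs_mul]
  rw [Finset.sum_congr rfl habs, ← hc _ (natDegree_T ℝ n).le, derivative_T_eval_one]
  simp

open Polynomial Polynomial.Chebyshev in
/-- The Markov inequality at the right end point of `[1/2, 1]`, in dual form. -/
lemma exists_eval_one_derivative_eq_sum (n : ℕ) :
    ∃ c t : ℕ → ℝ, ∑ i ∈ Finset.range (n + 1), |c i| ≤ 4 * (n : ℝ) ^ 2 ∧
      (∀ i, t i ∈ Set.Icc (1 / 2 : ℝ) 1) ∧
      ∀ P : ℝ[X], P.natDegree ≤ n →
        P.derivative.eval 1 = ∑ i ∈ Finset.range (n + 1), c i * P.eval (t i) := by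
  obtain ⟨c, hc, h⟩ := exists_eval_one_derivative_eq_sum_node n
  refine ⟨fun i => 4 * c i, fun i => (3 + node n i) / 4, ?_, fun i => ?_, fun P hP => ?_⟩
  · simp only [abs_mul, ← Finset.mul_sum]
    norm_num
    exact hc
  · have := node_mem_Icc (n := n) (i := i)
    constructor <;> linarith [this.1, this.2]
  · have hQ := h (P.comp (C (3 / 4) + C (1 / 4) * X)) ?_
    · simp only [derivative_comp, eval_mul, eval_comp, eval_add, eval_C, eval_X, derivative_add,
        derivative_C, derivative_mul, derivative_X] at hQ
      norm_num at hQ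
      have h4 : P.derivative.eval 1 = 4 * (1 / 4 * P.derivative.eval 1) := by ring
      rw [h4, hQ, Finset.mul_sum]
      refine Finset.sum_congr rfl fun i _ => ?_
      rw [mul_assoc]
      congr 3
      ring
    · refine (natDegree_comp_le).trans ?_
      refine (Nat.mul_le_mul hP (?_ : _ ≤ 1)).trans (by simp)
      compute_degree

/-- The restriction of `v` to the line through `z` and `y`. -/
noncomputable def MvPolynomial.restrictLine {σ : Type*} (v : MvPolynomial σ ℝ) (z y : σ → ℝ) :
    Polynomial ℝ :=
  MvPolynomial.aeval
    (fun j => Polynomial.C (z j) + Polynomial.C (y j - z j) * Polynomial.X) v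

lemma MvPolynomial.natDegree_restrictLine_le {σ : Type*} (v : MvPolynomial σ ℝ) (z y : σ → ℝ) :
    (v.restrictLine z y).natDegree ≤ v.totalDegree := by
  refine (MvPolynomial.aeval_natDegree_le (n := 1) v le_rfl _ fun j => ?_).trans_eq (mul_one _)
  compute_degree

lemma MvPolynomial.eval_restrictLine {σ : Type*} (v : MvPolynomial σ ℝ) (z y : σ → ℝ) (t : ℝ) :
    (v.restrictLine z y).eval t = MvPolynomial.eval (fun j => z j + (y j - z j) * t) v := by
  induction v using MvPolynomial.induction_on with
  | C a => simp [restrictLine]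
  | add p q hp hq => simp_all [restrictLine]
  | mul_X p i hp => simp_all [restrictLine]

lemma MvPolynomial.eval_one_derivative_restrictLine {σ : Type*} [Fintype σ]
    (v : MvPolynomial σ ℝ) (z y : σ → ℝ) :
    (v.restrictLine z y).derivative.eval 1 =
      ∑ i, (y i - z i) * MvPolynomial.eval y (MvPolynomial.pderiv i v) := by
  classical
  induction v using MvPolynomial.induction_on with
  | C a => simp [restrictLine]
  | add p q hp hq =>
    simp only [restrictLine, map_add, Polynomial.eval_add, mul_add, Finset.sum_add_distrib] at *
    rw [hp, hq]
  | mul_X p i hp =>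
    have he := p.eval_restrictLine z y 1
    simp only [mul_one, add_sub_cancel] at he
    simp only [restrictLine] at hp he
    simp only [restrictLine, map_mul, MvPolynomial.aeval_X, Polynomial.derivative_mul,
      Polynomial.eval_add, Polynomial.eval_mul, hp, he, Derivation.leibniz,
      MvPolynomial.pderiv_X, smul_eq_mul, map_add, MvPolynomial.eval_X]
    simp [Pi.single_apply, mul_add, Finset.sum_add_distrib, Finset.sum_mul, apply_ite]
    rw [add_comm, mul_comm]
    congr 1
    exact Finset.sum_congr rfl fun j _ => by ring

/-- Contracting a star-shaped set towards its centre controls integrals of nonnegative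
functions. -/
lemma setIntegral_comp_homothety_le {E : Type*} [NormedAddCommGroup E] [NormedSpace ℝ E]
    [MeasurableSpace E] [BorelSpace E] [FiniteDimensional ℝ E] (μ : Measure E)
    [μ.IsAddHaarMeasure] {K : Set E} (hK : MeasurableSet K) {z : E} (hz : StarConvex ℝ z K)
    {f : E → ℝ} (hf : ∀ y, 0 ≤ f y) (hfi : IntegrableOn f K μ) {t : ℝ} (ht : 0 < t)
    (ht1 : t ≤ 1) :
    ∫ y in K, f (z + t • (y - z)) ∂μ ≤ (t ^ Module.finrank ℝ E)⁻¹ * ∫ y in K, f y ∂μ := by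
  have hg : Integrable (K.indicator f) μ := (integrable_indicator_iff hK).mpr hfi
  have hgc : Integrable (fun y => K.indicator f (z + t • (y - z))) μ :=
    ((hg.comp_add_left z).comp_smul ht.ne').comp_sub_right z
  calc ∫ y in K, f (z + t • (y - z)) ∂μ
      = ∫ y, K.indicator (fun y => f (z + t • (y - z))) y ∂μ := (integral_indicator hK).symm
    _ ≤ ∫ y, K.indicator f (z + t • (y - z)) ∂μ := by
        refine integral_mono_of_nonneg (.of_forall fun y => Set.indicator_nonneg
          (fun _ _ => hf _) y) hgc (.of_forall fun y => ?_)
        by_cases hy : y ∈ K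
        · have hmem : z + t • (y - z) ∈ K := hz.add_smul_sub_mem hy ht.le ht1
          simp [hy, hmem]
        · simpa [hy] using Set.indicator_nonneg (fun _ _ => hf _) _
    _ = ∫ y, K.indicator f (z + t • y) ∂μ :=
        integral_sub_right_eq_self (fun y => K.indicator f (z + t • y)) z
    _ = (t ^ Module.finrank ℝ E)⁻¹ * ∫ y, K.indicator f (z + y) ∂μ := by
        rw [Measure.integral_comp_smul_of_nonneg μ (fun y => K.indicator f (z + y)) t
          (hR := ht.le), smul_eq_mul]
    _ = (t ^ Module.finrank ℝ E)⁻¹ * ∫ y in K, f y ∂μ := by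
        rw [integral_add_left_eq_self, integral_indicator hK]

section

variable {d : ℕ}

lemma MvPolynomial.continuous_eval_euclidean (v : MvPolynomial (Fin d) ℝ) :
    Continuous fun y : EuclideanSpace ℝ (Fin d) => MvPolynomial.eval (fun j => y j) v :=
  v.continuous_eval.comp (by fun_prop)

lemma Continuous.integrableOn_of_isBounded {E : Type*} [NormedAddCommGroup E] [NormedSpace ℝ E]
    [MeasurableSpace E] [BorelSpace E] [FiniteDimensional ℝ E] {μ : Measure E}
    [IsFiniteMeasureOnCompacts μ] {f : E → ℝ} (hf : Continuous f) {K : Set E}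
    (hK : Bornology.IsBounded K) : IntegrableOn f K μ :=
  have := FiniteDimensional.proper ℝ E
  (hf.continuousOn.integrableOn_compact hK.isCompact_closure).mono_set subset_closure

/-- Bound for the derivative in the direction away from a centre of star-shapedness. -/
lemma setIntegral_radial_derivative_sq_le {K : Set (EuclideanSpace ℝ (Fin d))} (hK : IsOpen K)
    (hKb : Bornology.IsBounded K) {z : EuclideanSpace ℝ (Fin d)} (hz : StarConvex ℝ z K)
    {p : ℕ} {v : MvPolynomial (Fin d) ℝ} (hv : v.totalDegree ≤ p) :
    ∫ y in K, (∑ i, (y i - z i) * MvPolynomial.eval (fun j => y j) (MvPolynomial.pderiv i v)) ^ 2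
      ≤ 16 * (p : ℝ) ^ 4 * 2 ^ d * ∫ y in K, (MvPolynomial.eval (fun j => y j) v) ^ 2 := by
  obtain ⟨c, t, hc, ht, hP⟩ := exists_eval_one_derivative_eq_sum p
  set f : EuclideanSpace ℝ (Fin d) → ℝ := fun y => (MvPolynomial.eval (fun j => y j) v) ^ 2
    with hf
  have hfc : Continuous f := v.continuous_eval_euclidean.pow 2
  have hI : 0 ≤ ∫ y in K, f y := integral_nonneg fun y => sq_nonneg _
  have hS : 0 ≤ ∑ i ∈ Finset.range (p + 1), |c i| := Finset.sum_nonneg fun _ _ => abs_nonneg _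
  have hint : ∀ i, IntegrableOn (fun y => |c i| * f (z + t i • (y - z))) K := fun i =>
    Continuous.integrableOn_of_isBounded (by fun_prop) hKb
  have hpt : ∀ y : EuclideanSpace ℝ (Fin d),
      (∑ i, (y i - z i) * MvPolynomial.eval (fun j => y j) (MvPolynomial.pderiv i v)) ^ 2 ≤
        (∑ i ∈ Finset.range (p + 1), |c i|) *
          ∑ i ∈ Finset.range (p + 1), |c i| * f (z + t i • (y - z)) := by
    intro y
    rw [← v.eval_one_derivative_restrictLine (fun j => z j) (fun j => y j),
      hP _ ((v.natDegree_restrictLine_le _ _).trans hv)]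
    refine Finset.sum_sq_le_sum_mul_sum_of_sq_le_mul _ (fun _ _ => abs_nonneg _)
      (fun _ _ => mul_nonneg (abs_nonneg _) (sq_nonneg _)) fun i _ => le_of_eq ?_
    rw [MvPolynomial.eval_restrictLine, mul_pow, ← mul_assoc, abs_mul_abs_self, ← sq]
    simp [hf, mul_comm]
  calc _ ≤ ∫ y in K, (∑ i ∈ Finset.range (p + 1), |c i|) *
          ∑ i ∈ Finset.range (p + 1), |c i| * f (z + t i • (y - z)) :=
        integral_mono_of_nonneg (.of_forall fun y => sq_nonneg _)
          ((integrable_finsetSum _ fun i _ => hint i).const_mul _) (.of_forall hpt)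
    _ = (∑ i ∈ Finset.range (p + 1), |c i|) *
          ∑ i ∈ Finset.range (p + 1), |c i| * ∫ y in K, f (z + t i • (y - z)) := by
        rw [integral_const_mul, integral_finsetSum _ fun i _ => hint i]
        simp only [integral_const_mul]
    _ ≤ (∑ i ∈ Finset.range (p + 1), |c i|) *
          ∑ i ∈ Finset.range (p + 1), |c i| * (2 ^ d * ∫ y in K, f y) := by
        gcongr with i _
        have h2 := (ht i).1
        have hpos : 0 < t i := by linarith
        refine (setIntegral_comp_homothety_le volume hK.measurableSet hz (fun y => sq_nonneg _)
          (hfc.integrableOn_of_isBounded hKb) hpos (ht i).2).trans ?_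
        gcongr
        rw [finrank_euclideanSpace_fin, ← inv_pow]
        gcongr
        rw [inv_le_comm₀ hpos two_pos]
        linarith
    _ = (∑ i ∈ Finset.range (p + 1), |c i|) ^ 2 * (2 ^ d * ∫ y in K, f y) := by
        rw [← Finset.sum_mul]
        ring
    _ ≤ (4 * (p : ℝ) ^ 2) ^ 2 * (2 ^ d * ∫ y in K, f y) := by gcongr
    _ = _ := by ring

/-- A partial derivative is a difference of radial derivatives about two centres. -/
lemma setIntegral_pderiv_sq_le {K : Set (EuclideanSpace ℝ (Fin d))} (hK : IsOpen K)
    (hKb : Bornology.IsBounded K) {z : EuclideanSpace ℝ (Fin d)} {r : ℝ} (hr : 0 < r)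
    {i : Fin d} (hz : StarConvex ℝ z K) (hzi : StarConvex ℝ (z + EuclideanSpace.single i r) K)
    {p : ℕ} {v : MvPolynomial (Fin d) ℝ} (hv : v.totalDegree ≤ p) :
    ∫ y in K, (MvPolynomial.eval (fun j => y j) (MvPolynomial.pderiv i v)) ^ 2 ≤
      64 * 2 ^ d * ((p : ℝ) ^ 4 / r ^ 2) *
        ∫ y in K, (MvPolynomial.eval (fun j => y j) v) ^ 2 := by
  set D : EuclideanSpace ℝ (Fin d) → EuclideanSpace ℝ (Fin d) → ℝ := fun w y =>
    ∑ i, (y i - w i) * MvPolynomial.eval (fun j => y j) (MvPolynomial.pderiv i v) with hD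
  have hDi : ∀ w, IntegrableOn (fun y => D w y ^ 2) K := fun w => by
    refine Continuous.integrableOn_of_isBounded ?_ hKb
    have := fun i => (MvPolynomial.pderiv i v).continuous_eval_euclidean
    fun_prop
  have hpt : ∀ y, (MvPolynomial.eval (fun j => y j) (MvPolynomial.pderiv i v)) ^ 2 ≤
      2 / r ^ 2 * (D z y ^ 2 + D (z + EuclideanSpace.single i r) y ^ 2) := by
    intro y
    have h : r * MvPolynomial.eval (fun j => y j) (MvPolynomial.pderiv i v) =
        D z y - D (z + EuclideanSpace.single i r) y := by
      simp [hD, ← Finset.sum_sub_distrib, ← sub_mul]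
    rw [div_mul_eq_mul_div, le_div_iff₀ (by positivity), mul_comm, ← mul_pow, h]
    nlinarith [sq_nonneg (D z y + D (z + EuclideanSpace.single i r) y)]
  calc _ ≤ ∫ y in K, 2 / r ^ 2 * (D z y ^ 2 + D (z + EuclideanSpace.single i r) y ^ 2) :=
        integral_mono_of_nonneg (.of_forall fun y => sq_nonneg _)
          (((hDi _).add (hDi _)).const_mul _) (.of_forall hpt)
    _ = 2 / r ^ 2 * (∫ y in K, D z y ^ 2) +
          2 / r ^ 2 * ∫ y in K, D (z + EuclideanSpace.single i r) y ^ 2 := by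
        rw [integral_const_mul, integral_add (hDi _) (hDi _), mul_add]
    _ ≤ _ := by
        refine (add_le_add
          (mul_le_mul_of_nonneg_left (setIntegral_radial_derivative_sq_le hK hKb hz hv)
            (by positivity))
          (mul_le_mul_of_nonneg_left (setIntegral_radial_derivative_sq_le hK hKb hzi hv)
            (by positivity))).trans_eq ?_
        ring

end

/-- **`H¹–L₂` inverse estimate on domains star-shaped with respect to a ball**
(the Corollary after Lemma `curved_inv_est_h1l2`).
There is a constant `C(d) > 0`, depending only on the dimension `d`, such that for every
domain `K ⊂ ℝ^d` star-shaped with respect to a ball `B(x, ρ_K) ⊆ K`, every `p ∈ ℕ`, and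
every real polynomial `v` of total degree at most `p` in `d` variables,
`∫_K |∇v|² ≤ C(d) (h_K/ρ_K)^{d+5} (p⁴/ρ_K²) ∫_K v²`, where `h_K = diam K`. -/
theorem H1_L2_inverse_estimate_star_shaped_wrt_ball
    (d : ℕ) (hd : 2 ≤ d) :
    ∃ C : ℝ, 0 < C ∧
      ∀ (K : Set (EuclideanSpace ℝ (Fin d))) (x : EuclideanSpace ℝ (Fin d)) (ρ : ℝ),
        0 < ρ → IsOpen K → Bornology.IsBounded K →
        Metric.ball x ρ ⊆ K →
        (∀ y ∈ K, ∀ z ∈ Metric.ball x ρ, segment ℝ y z ⊆ K) →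
        ∀ (p : ℕ) (v : MvPolynomial (Fin d) ℝ), v.totalDegree ≤ p →
          ∫ y in K,
              (∑ i : Fin d, (MvPolynomial.eval (fun j => y j) (MvPolynomial.pderiv i v)) ^ 2) ≤
            C * (Metric.diam K / ρ) ^ (d + 5) * ((p : ℝ) ^ 4 / ρ ^ 2) *
              ∫ y in K, (MvPolynomial.eval (fun j => y j) v) ^ 2 := by
  refine ⟨d * (256 * 2 ^ d) * 2 ^ (d + 5), by positivity, ?_⟩
  intro K x ρ hρ hK hKb hball hstar p v hv
  have hsc : ∀ z ∈ Metric.ball x ρ, StarConvex ℝ z K := fun z hz =>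
    starConvex_iff_segment_subset.mpr fun y hy => by
      rw [segment_symm]
      exact hstar y hy z hz
  have hmem : ∀ i : Fin d, x + EuclideanSpace.single i (ρ / 2) ∈ Metric.ball x ρ := fun i => by
    simp [abs_of_pos hρ, hρ]
  have hx : x ∈ Metric.ball x ρ := Metric.mem_ball_self hρ
  have hI : 0 ≤ ∫ y in K, (MvPolynomial.eval (fun j => y j) v) ^ 2 :=
    integral_nonneg fun y => sq_nonneg _
  have hdiam : 1 / 2 ≤ Metric.diam K / ρ := by
    have h := Metric.dist_le_diam_of_mem hKb (hball (hmem ⟨0, by omega⟩)) (hball hx)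
    simp only [dist_self_add_left, PiLp.norm_single, Real.norm_eq_abs] at h
    rw [abs_of_pos (by positivity)] at h
    rw [le_div_iff₀ hρ]
    linarith
  have hfac : 1 ≤ 2 ^ (d + 5) * (Metric.diam K / ρ) ^ (d + 5) := by
    rw [← mul_pow]
    exact one_le_pow₀ (by linarith)
  calc _ = ∑ i : Fin d, ∫ y in K,
          (MvPolynomial.eval (fun j => y j) (MvPolynomial.pderiv i v)) ^ 2 :=
        integral_finsetSum _ fun i _ => by
          have := (MvPolynomial.pderiv i v).continuous_eval_euclidean
          exact Continuous.integrableOn_of_isBounded (by fun_prop) hKb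
    _ ≤ ∑ _i : Fin d, 64 * 2 ^ d * ((p : ℝ) ^ 4 / (ρ / 2) ^ 2) *
          ∫ y in K, (MvPolynomial.eval (fun j => y j) v) ^ 2 :=
        Finset.sum_le_sum fun i _ =>
          setIntegral_pderiv_sq_le hK hKb (half_pos hρ) (hsc x hx) (hsc _ (hmem i)) hv
    _ = 1 * (d * (256 * 2 ^ d) * ((p : ℝ) ^ 4 / ρ ^ 2) *
          ∫ y in K, (MvPolynomial.eval (fun j => y j) v) ^ 2) := by
        simp only [Finset.sum_const, Finset.card_univ, Fintype.card_fin, nsmul_eq_mul]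
        field_simp
        ring
    _ ≤ (2 ^ (d + 5) * (Metric.diam K / ρ) ^ (d + 5)) *
          (d * (256 * 2 ^ d) * ((p : ℝ) ^ 4 / ρ ^ 2) *
            ∫ y in K, (MvPolynomial.eval (fun j => y j) v) ^ 2) := by gcongr
    _ = _ := by ring
end

section
/- Let R > 0, p ∈ ℕ, and let v be a real polynomial in two variables of total degree at most p. Then ∫_{B(0,R)} |∇v|² dx ≤ 9 p (p+1)² (p+2) R^{−2} ∫_{B(0,R)} v² dx, where B(0,R) ⊂ ℝ² is the open disc of radius R centred at the origin. -/
open MeasureTheory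
open MvPolynomial

theorem MvPolynomial.hasDerivAt_eval_insertNth {n : ℕ} (i : Fin (n + 1)) (y : Fin n → ℝ)
    (g : MvPolynomial (Fin (n + 1)) ℝ) (x : ℝ) :
    HasDerivAt (fun t : ℝ => eval (i.insertNth t y : Fin (n + 1) → ℝ) g)
      (eval (i.insertNth x y : Fin (n + 1) → ℝ) (pderiv i g)) x := by
  induction g using MvPolynomial.induction_on with
  | C a => simpa using hasDerivAt_const x a
  | add p q hp hq => simpa using hp.fun_add hq
  | mul_X p j hp =>
    have hX : HasDerivAt (fun t : ℝ => (i.insertNth t y : Fin (n + 1) → ℝ) j)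
        (eval (i.insertNth x y : Fin (n + 1) → ℝ) (pderiv i (X j))) x := by
      induction j using i.succAboveCases with
      | x => simpa using hasDerivAt_id' x
      | p j => simpa [pderiv_X_of_ne] using hasDerivAt_const x (y j)
    convert! hp.fun_mul hX using 1
    · simp
    · simp only [pderiv_mul, map_add, map_mul, eval_X]

theorem MvPolynomial.continuous_eval_insertNth {n : ℕ} (i : Fin (n + 1)) (y : Fin n → ℝ)
    (g : MvPolynomial (Fin (n + 1)) ℝ) :
    Continuous fun t : ℝ => eval (i.insertNth t y : Fin (n + 1) → ℝ) g :=
  continuous_iff_continuousAt.2 fun t => (hasDerivAt_eval_insertNth i y g t).continuousAt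

/-- The polynomial `R² - x² - y²`, vanishing on the circle of radius `R`. -/
noncomputable def discBubble (R : ℝ) : MvPolynomial (Fin 2) ℝ :=
  C (R ^ 2) - X 0 ^ 2 - X 1 ^ 2

theorem eval_discBubble (R : ℝ) (x : Fin 2 → ℝ) :
    eval x (discBubble R) = R ^ 2 - ∑ i, x i ^ 2 := by
  simp [discBubble, Fin.sum_univ_two]; ring

theorem mem_ball_iff_eval_discBubble_pos {R : ℝ} (hR : 0 < R) (x : EuclideanSpace ℝ (Fin 2)) :
    x ∈ Metric.ball 0 R ↔ 0 < eval (fun j => x j) (discBubble R) := by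
  rw [EuclideanSpace.ball_zero_eq _ hR.le, eval_discBubble]
  simp

theorem continuous_eval_ofLp (f : MvPolynomial (Fin 2) ℝ) :
    Continuous fun x : EuclideanSpace ℝ (Fin 2) => eval (fun j => x j) f :=
  (MvPolynomial.continuous_eval f).comp (by fun_prop)

theorem integrableOn_ball_eval (R : ℝ) (f : MvPolynomial (Fin 2) ℝ) :
    IntegrableOn (fun x : EuclideanSpace ℝ (Fin 2) => eval (fun j => x j) f)
      (Metric.ball 0 R) :=
  ((continuous_eval_ofLp f).continuousOn.integrableOn_compact
    (isCompact_closedBall 0 R)).mono_set Metric.ball_subset_closedBall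

/-- Integration over the disc of radius `R`, as a linear functional on polynomials. -/
noncomputable def discIntegral (R : ℝ) : MvPolynomial (Fin 2) ℝ →ₗ[ℝ] ℝ where
  toFun f := ∫ x in Metric.ball (0 : EuclideanSpace ℝ (Fin 2)) R, eval (fun j => x j) f
  map_add' f g := by
    simp only [map_add]
    exact integral_add (integrableOn_ball_eval R f) (integrableOn_ball_eval R g)
  map_smul' c f := by
    simp only [smul_eval, RingHom.id_apply, smul_eq_mul]
    exact integral_const_mul _ _

theorem discIntegral_apply (R : ℝ) (f : MvPolynomial (Fin 2) ℝ) :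
    discIntegral R f =
      ∫ x in Metric.ball (0 : EuclideanSpace ℝ (Fin 2)) R, eval (fun j => x j) f := rfl

theorem integral_insertNth_pderiv_discBubble_mul (R : ℝ) (i : Fin 2) (y : Fin 1 → ℝ)
    (f : MvPolynomial (Fin 2) ℝ) :
    ∫ t in {t : ℝ | 0 < eval (i.insertNth t y : Fin 2 → ℝ) (discBubble R)},
      eval (i.insertNth t y : Fin 2 → ℝ) (pderiv i (discBubble R * f)) = 0 := by
  have hb (t : ℝ) : eval (i.insertNth t y : Fin 2 → ℝ) (discBubble R) =
      R ^ 2 - y 0 ^ 2 - t ^ 2 := by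
    rw [eval_discBubble, Fin.sum_univ_succAbove _ i]
    simp; ring
  simp only [hb]
  set a := R ^ 2 - y 0 ^ 2
  rcases le_or_gt a 0 with h | h
  · have : {t : ℝ | 0 < a - t ^ 2} = ∅ := by
      ext t
      simp only [Set.mem_ofPred_eq, Set.mem_empty_iff_false, iff_false]
      nlinarith [sq_nonneg t]
    rw [this, Measure.restrict_empty, integral_zero_measure]
  · have hs : {t : ℝ | 0 < a - t ^ 2} = Set.Ioo (-√a) (√a) := by
      ext t
      simp only [Set.mem_ofPred_eq, sub_pos, Set.mem_Ioo, Real.sq_lt]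
    rw [hs, ← integral_Ioc_eq_integral_Ioo,
      ← intervalIntegral.integral_of_le (by linarith [Real.sqrt_nonneg a]),
      intervalIntegral.integral_eq_sub_of_hasDerivAt
        (fun t _ => MvPolynomial.hasDerivAt_eval_insertNth i y _ t)
        ((continuous_eval_insertNth i y _).intervalIntegrable _ _)]
    simp [hb, Real.sq_sqrt h.le]

theorem discIntegral_pderiv_discBubble_mul {R : ℝ} (hR : 0 < R) (i : Fin 2)
    (f : MvPolynomial (Fin 2) ℝ) :
    discIntegral R (pderiv i (discBubble R * f)) = 0 := by
  set g := pderiv i (discBubble R * f)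
  set s : Set (Fin 2 → ℝ) := {x | 0 < eval x (discBubble R)}
  have hsm : MeasurableSet s :=
    (isOpen_lt continuous_const (MvPolynomial.continuous_eval _)).measurableSet
  have hball : Metric.ball (0 : EuclideanSpace ℝ (Fin 2)) R =
      WithLp.ofLp ⁻¹' s := by
    ext x
    exact mem_ball_iff_eval_discBubble_pos hR x
  have e₁ := PiLp.volume_preserving_ofLp (Fin 2)
  have hemb : MeasurableEmbedding (WithLp.ofLp : EuclideanSpace ℝ (Fin 2) → Fin 2 → ℝ) :=
    (MeasurableEquiv.toLp 2 (Fin 2 → ℝ)).symm.measurableEmbedding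
  have e₂ := (volume_preserving_piFinSuccAbove (fun _ : Fin 2 => ℝ) i).symm
  have hint : IntegrableOn (fun x => eval x g) s := by
    rw [← e₁.integrableOn_comp_preimage hemb, ← hball]
    exact integrableOn_ball_eval R g
  have hI : discIntegral R g = ∫ x in s, eval x g := by
    rw [discIntegral_apply, hball]
    exact e₁.setIntegral_preimage_emb hemb (fun x => eval x g) s
  rw [← integrable_indicator_iff hsm, ← e₂.integrable_comp_emb
    (MeasurableEquiv.measurableEmbedding _)] at hint
  rw [hI, ← integral_indicator hsm, ← e₂.integral_comp (MeasurableEquiv.measurableEmbedding _),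
    Measure.volume_eq_prod, integral_prod_symm _ (by exact hint)]
  refine integral_eq_zero_of_ae (Filter.Eventually.of_forall fun y => ?_)
  refine Eq.trans ?_ (integral_insertNth_pderiv_discBubble_mul R i y f)
  rw [← integral_indicator]
  · rfl
  · exact (isOpen_lt continuous_const (continuous_eval_insertNth i y _)).measurableSet

theorem discIntegral_nonneg {R : ℝ} (hR : 0 < R) {f : MvPolynomial (Fin 2) ℝ}
    (h : ∀ x, 0 < eval x (discBubble R) → 0 ≤ eval x f) : 0 ≤ discIntegral R f :=
  setIntegral_nonneg Metric.isOpen_ball.measurableSet fun x hx =>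
    h _ ((mem_ball_iff_eval_discBubble_pos hR x).1 hx)

theorem eq_zero_of_discIntegral_mul_self {R : ℝ} (hR : 0 < R) {f : MvPolynomial (Fin 2) ℝ}
    (h : discIntegral R (f * f) = 0) : f = 0 := by
  rw [discIntegral_apply, setIntegral_eq_zero_iff_of_nonneg_ae
    (Filter.Eventually.of_forall fun x => by simpa using mul_self_nonneg _)
    (integrableOn_ball_eval R _)] at h
  have h' := Measure.eqOn_open_of_ae_eq h Metric.isOpen_ball
    (continuous_eval_ofLp _).continuousOn continuousOn_const
  refine funext_set (fun _ => Set.Ioo 0 (R / 2)) (fun _ => Set.Ioo_infinite (by linarith))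
    fun x hx => ?_
  have := h' (x := WithLp.toLp 2 x) <| by
    rw [mem_ball_iff_eval_discBubble_pos hR, eval_discBubble, Fin.sum_univ_two]
    have h0 := hx 0 trivial
    have h1 := hx 1 trivial
    simp only [Set.mem_Ioo] at h0 h1
    nlinarith
  simpa using this

/-- The Euler derivation `x ∂ₓ + y ∂ᵧ`. -/
noncomputable def planeEuler : Derivation ℝ (MvPolynomial (Fin 2) ℝ) (MvPolynomial (Fin 2) ℝ) :=
  (X 0 : MvPolynomial (Fin 2) ℝ) • pderiv 0 + (X 1 : MvPolynomial (Fin 2) ℝ) • pderiv 1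

/-- The angular derivation `x ∂ᵧ - y ∂ₓ`. -/
noncomputable def planeRotation : Derivation ℝ (MvPolynomial (Fin 2) ℝ) (MvPolynomial (Fin 2) ℝ) :=
  (X 0 : MvPolynomial (Fin 2) ℝ) • pderiv 1 - (X 1 : MvPolynomial (Fin 2) ℝ) • pderiv 0

theorem planeEuler_apply (v : MvPolynomial (Fin 2) ℝ) :
    planeEuler v = X 0 * pderiv 0 v + X 1 * pderiv 1 v := rfl

theorem planeRotation_apply (v : MvPolynomial (Fin 2) ℝ) :
    planeRotation v = X 0 * pderiv 1 v - X 1 * pderiv 0 v := rfl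

theorem MvPolynomial.pderiv_pderiv_comm {R σ : Type*} [CommRing R] (i j : σ)
    (f : MvPolynomial σ R) : pderiv i (pderiv j f) = pderiv j (pderiv i f) := by
  classical
  have h : ⁅pderiv i, pderiv j⁆ = (0 : Derivation R (MvPolynomial σ R) (MvPolynomial σ R)) :=
    MvPolynomial.derivation_ext fun k => by
      rw [Derivation.commutator_apply, pderiv_X, pderiv_X, Pi.single_apply, Pi.single_apply]
      split_ifs <;> simp
  simpa [Derivation.commutator_apply, sub_eq_zero] using DFunLike.congr_fun h f

/-- The differential operator whose eigenfunctions in `L²` of the disc of radius `R` are the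
Zernike polynomials. -/
noncomputable def zernikeOperator (R : ℝ) (v : MvPolynomial (Fin 2) ℝ) : MvPolynomial (Fin 2) ℝ :=
  planeEuler (planeEuler v) + 2 * planeEuler v
    - C (R ^ 2) * (pderiv 0 (pderiv 0 v) + pderiv 1 (pderiv 1 v))

theorem discBubble_form_sub_zernikeOperator_mul (R : ℝ) (v w : MvPolynomial (Fin 2) ℝ) :
    discBubble R * (pderiv 0 v * pderiv 0 w + pderiv 1 v * pderiv 1 w)
        + planeRotation v * planeRotation w - zernikeOperator R v * w =
      pderiv 0 (discBubble R * (pderiv 0 v * w)) + pderiv 1 (discBubble R * (pderiv 1 v * w))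
        + planeRotation (planeRotation v * w) := by
  simp only [zernikeOperator, planeEuler_apply, planeRotation_apply, discBubble, pderiv_mul,
    map_add, map_sub, pderiv_C, pderiv_X_self, pderiv_pow,
    pderiv_X_of_ne (show (0 : Fin 2) ≠ 1 by decide),
    pderiv_X_of_ne (show (1 : Fin 2) ≠ 0 by decide), pderiv_pderiv_comm 1 0 v]
  push_cast
  ring

theorem coeff_planeEuler (v : MvPolynomial (Fin 2) ℝ) (m : Fin 2 →₀ ℕ) :
    coeff m (planeEuler v) = (m.degree : ℝ) * coeff m v := by
  induction v using MvPolynomial.induction_on' with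
  | monomial u a =>
    have h (i : Fin 2) : X i * pderiv i (monomial u a) = u i • monomial u a :=
      X_mul_pderiv_monomial
    rw [planeEuler_apply, h, h, ← add_smul, ← Fin.sum_univ_two, ← Finsupp.degree_eq_sum,
      coeff_smul, coeff_monomial, nsmul_eq_mul]
    split_ifs with hm
    · rw [hm]
    · simp
  | add p q hp hq => rw [map_add, coeff_add, hp, hq, coeff_add, mul_add]

theorem MvPolynomial.mem_restrictTotalDegree_iff_coeff {σ R : Type*} [CommSemiring R] {k : ℕ}
    {v : MvPolynomial σ R} :
    v ∈ restrictTotalDegree σ R k ↔ ∀ m, coeff m v ≠ 0 → m.degree ≤ k := by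
  rw [mem_restrictTotalDegree, totalDegree, Finset.sup_le_iff]
  simp only [mem_support_iff]
  rfl

theorem MvPolynomial.pderiv_mem_restrictTotalDegree {σ R : Type*} [CommSemiring R] {k : ℕ}
    {v : MvPolynomial σ R} (i : σ) (hv : v ∈ restrictTotalDegree σ R (k + 1)) :
    pderiv i v ∈ restrictTotalDegree σ R k := by
  rw [mem_restrictTotalDegree_iff_coeff] at *
  intro m hm
  rw [coeff_pderiv] at hm
  simpa using hv _ (left_ne_zero_of_mul hm)

theorem planeEuler_mem_restrictTotalDegree {k : ℕ} {v : MvPolynomial (Fin 2) ℝ}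
    (hv : v ∈ restrictTotalDegree (Fin 2) ℝ k) :
    planeEuler v ∈ restrictTotalDegree (Fin 2) ℝ k := by
  rw [mem_restrictTotalDegree_iff_coeff] at *
  intro m hm
  rw [coeff_planeEuler] at hm
  exact hv m (right_ne_zero_of_mul hm)

theorem planeEuler_sub_smul_mem_restrictTotalDegree {k : ℕ} {v : MvPolynomial (Fin 2) ℝ}
    (hv : v ∈ restrictTotalDegree (Fin 2) ℝ (k + 1)) :
    planeEuler v - (k + 1 : ℝ) • v ∈ restrictTotalDegree (Fin 2) ℝ k := by
  rw [mem_restrictTotalDegree_iff_coeff] at *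
  intro m hm
  rw [coeff_sub, coeff_planeEuler, coeff_smul, smul_eq_mul, ← sub_mul] at hm
  have h₁ := hv m (right_ne_zero_of_mul hm)
  have h₂ : m.degree ≠ k + 1 := fun h => left_ne_zero_of_mul hm (by simp [h])
  omega

theorem zernikeOperator_sub_smul_mem_restrictTotalDegree (R : ℝ) {k : ℕ}
    {v : MvPolynomial (Fin 2) ℝ} (hv : v ∈ restrictTotalDegree (Fin 2) ℝ (k + 1)) :
    zernikeOperator R v - ((k + 1) * (k + 3) : ℝ) • v ∈ restrictTotalDegree (Fin 2) ℝ k := by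
  have hd (i : Fin 2) : pderiv i (pderiv i v) ∈ restrictTotalDegree (Fin 2) ℝ k := by
    have h := pderiv_mem_restrictTotalDegree i hv
    rw [mem_restrictTotalDegree_iff_coeff] at h ⊢
    intro m hm
    rw [coeff_pderiv] at hm
    have := h _ (left_ne_zero_of_mul hm)
    simp at this
    omega
  have he := planeEuler_sub_smul_mem_restrictTotalDegree hv
  have key : zernikeOperator R v - ((k + 1) * (k + 3) : ℝ) • v =
      planeEuler (planeEuler v - (k + 1 : ℝ) • v)
        + (k + 3 : ℝ) • (planeEuler v - (k + 1 : ℝ) • v)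
        - (R ^ 2) • (pderiv 0 (pderiv 0 v) + pderiv 1 (pderiv 1 v)) := by
    rw [zernikeOperator, map_sub, Derivation.map_smul]
    simp only [smul_eq_C_mul, map_mul, map_add, map_one, map_ofNat]
    ring
  rw [key]
  exact sub_mem (add_mem (planeEuler_mem_restrictTotalDegree he) (Submodule.smul_mem _ _ he))
    (Submodule.smul_mem _ _ (add_mem (hd 0) (hd 1)))

theorem zernikeOperator_mem_restrictTotalDegree (R : ℝ) {k : ℕ}
    {v : MvPolynomial (Fin 2) ℝ} (hv : v ∈ restrictTotalDegree (Fin 2) ℝ k) :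
    zernikeOperator R v ∈ restrictTotalDegree (Fin 2) ℝ k := by
  have hd (i : Fin 2) {w : MvPolynomial (Fin 2) ℝ} (hw : w ∈ restrictTotalDegree (Fin 2) ℝ k) :
      pderiv i w ∈ restrictTotalDegree (Fin 2) ℝ k := by
    refine pderiv_mem_restrictTotalDegree i ?_
    rw [mem_restrictTotalDegree] at hw ⊢
    omega
  have he := planeEuler_mem_restrictTotalDegree hv
  rw [zernikeOperator, ← smul_eq_C_mul, two_mul]
  exact sub_mem (add_mem (planeEuler_mem_restrictTotalDegree he) (add_mem he he))
    (Submodule.smul_mem _ _ (add_mem (hd 0 (hd 0 hv)) (hd 1 (hd 1 hv))))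

theorem discIntegral_planeRotation {R : ℝ} (hR : 0 < R) (f : MvPolynomial (Fin 2) ℝ) :
    discIntegral R (planeRotation f) = 0 := by
  have h (i : Fin 2) (g) : discIntegral R (discBubble R * pderiv i g) =
      2 * discIntegral R (X i * g) := by
    have h₁ := discIntegral_pderiv_discBubble_mul hR i g
    have h₂ : pderiv i (discBubble R * g) = discBubble R * pderiv i g - (2 : ℝ) • (X i * g) := by
      rw [smul_eq_C_mul, map_ofNat]
      fin_cases i <;> simp [discBubble] <;> ring
    rw [h₂, map_sub, map_smul, smul_eq_mul] at h₁
    linarith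
  have h₀ := h 0 (pderiv 1 f)
  have h₁ := h 1 (pderiv 0 f)
  rw [pderiv_pderiv_comm 1 0] at h₁
  rw [planeRotation_apply, map_sub]
  linarith

theorem discIntegral_zernikeOperator_mul {R : ℝ} (hR : 0 < R) (v w : MvPolynomial (Fin 2) ℝ) :
    discIntegral R (zernikeOperator R v * w) =
      discIntegral R (discBubble R * (pderiv 0 v * pderiv 0 w + pderiv 1 v * pderiv 1 w)
        + planeRotation v * planeRotation w) := by
  have h := congrArg (discIntegral R) (discBubble_form_sub_zernikeOperator_mul R v w)
  rw [map_sub, map_add _ (pderiv 0 _ + _), map_add _ (pderiv 0 _),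
    discIntegral_pderiv_discBubble_mul hR,
    discIntegral_pderiv_discBubble_mul hR, discIntegral_planeRotation hR] at h
  linarith

theorem discIntegral_zernikeOperator_mul_comm {R : ℝ} (hR : 0 < R)
    (v w : MvPolynomial (Fin 2) ℝ) :
    discIntegral R (zernikeOperator R v * w) = discIntegral R (v * zernikeOperator R w) := by
  rw [mul_comm v, discIntegral_zernikeOperator_mul hR, discIntegral_zernikeOperator_mul hR,
    mul_comm (pderiv 0 v), mul_comm (pderiv 1 v), mul_comm (planeRotation v)]

theorem exists_orthogonal_decomposition {R : ℝ} (hR : 0 < R) (k : ℕ)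
    (v : MvPolynomial (Fin 2) ℝ) :
    ∃ w ∈ restrictTotalDegree (Fin 2) ℝ k,
      ∀ q ∈ restrictTotalDegree (Fin 2) ℝ k, discIntegral R (q * (v - w)) = 0 := by
  let B : LinearMap.BilinForm ℝ (MvPolynomial (Fin 2) ℝ) :=
    (LinearMap.mul ℝ (MvPolynomial (Fin 2) ℝ)).compr₂ (discIntegral R)
  let W := restrictTotalDegree (Fin 2) ℝ k
  have hnd : (B.restrict W).Nondegenerate :=
    ⟨fun f hf => Subtype.ext (eq_zero_of_discIntegral_mul_self hR (hf f)),
      fun f hf => Subtype.ext (eq_zero_of_discIntegral_mul_self hR (hf f))⟩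
  let w := ((B.restrict W).toDual hnd).symm ((B v).domRestrict W)
  refine ⟨w, w.2, fun q hq => ?_⟩
  have h : discIntegral R (w * q) = discIntegral R (v * q) :=
    LinearMap.BilinForm.apply_toDual_symm_apply (B := B.restrict W) (hB := hnd)
      ((B v).domRestrict W) ⟨q, hq⟩
  rw [mul_comm, sub_mul, map_sub, h, sub_self]

theorem discIntegral_zernikeOperator_mul_self_le {R : ℝ} (hR : 0 < R) {k : ℕ}
    {v : MvPolynomial (Fin 2) ℝ} (hv : v ∈ restrictTotalDegree (Fin 2) ℝ k) :
    discIntegral R (zernikeOperator R v * v) ≤ k * (k + 2) * discIntegral R (v * v) := by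
  induction k generalizing v with
  | zero =>
    rw [mem_restrictTotalDegree, Nat.le_zero, totalDegree_eq_zero_iff_eq_C] at hv
    rw [hv]
    simp [zernikeOperator, planeEuler_apply]
  | succ k ih =>
    obtain ⟨w, hw, hu⟩ := exists_orthogonal_decomposition hR k v
    obtain ⟨u, rfl⟩ : ∃ u, v = w + u := ⟨v - w, by ring⟩
    rw [add_sub_cancel_left] at hu
    have hu' : u ∈ restrictTotalDegree (Fin 2) ℝ (k + 1) := by
      refine ((Submodule.add_mem_iff_right _ ?_).1 hv)
      rw [mem_restrictTotalDegree] at hw ⊢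
      omega
    have hL : zernikeOperator R (w + u) = zernikeOperator R w + zernikeOperator R u := by
      simp only [zernikeOperator, map_add]; ring
    have e₁ := hu _ (zernikeOperator_sub_smul_mem_restrictTotalDegree R hu')
    rw [sub_mul, smul_mul_assoc, map_sub, map_smul, smul_eq_mul] at e₁
    have e₂ := hu _ (zernikeOperator_mem_restrictTotalDegree R hw)
    have e₃ := discIntegral_zernikeOperator_mul_comm hR u w
    rw [mul_comm u] at e₃
    have e₄ := hu _ hw
    have e₅ : discIntegral R (u * w) = 0 := by rw [mul_comm, e₄]
    have hw0 : 0 ≤ discIntegral R (w * w) :=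
      discIntegral_nonneg hR fun x _ => by simpa using mul_self_nonneg _
    have := ih hw
    rw [hL]
    simp only [add_mul, mul_add, map_add, e₂, e₃, e₄, e₅]
    push_cast
    nlinarith [mul_nonneg (Nat.cast_nonneg (α := ℝ) k) hw0]

/-- The weighted Markov-type inequality on the disc. -/
theorem discIntegral_discBubble_mul_gradient_sq_le {R : ℝ} (hR : 0 < R) {k : ℕ}
    {v : MvPolynomial (Fin 2) ℝ} (hv : v ∈ restrictTotalDegree (Fin 2) ℝ k) :
    discIntegral R (discBubble R * (pderiv 0 v ^ 2 + pderiv 1 v ^ 2)) ≤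
      k * (k + 2) * discIntegral R (v ^ 2) := by
  have h := discIntegral_zernikeOperator_mul_self_le hR hv
  have h₁ : 0 ≤ discIntegral R (planeRotation v * planeRotation v) :=
    discIntegral_nonneg hR fun x _ => by simpa using mul_self_nonneg _
  rw [discIntegral_zernikeOperator_mul hR, map_add] at h
  simp only [sq]
  linarith

/-- On polynomials of degree at most `k`, the `L²` norm on the disc is controlled by the `L²` norm
weighted by `R² - x² - y²`. -/
theorem discIntegral_sq_le_discBubble_mul {R : ℝ} (hR : 0 < R) {k : ℕ}
    {q : MvPolynomial (Fin 2) ℝ} (hq : q ∈ restrictTotalDegree (Fin 2) ℝ k) :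
    R ^ 2 * discIntegral R (q ^ 2) ≤
      ((k + 1) ^ 2 + 4) * discIntegral R (discBubble R * q ^ 2) := by
  set t : ℝ := (k + 1) ^ 2 with ht
  have ht0 : 0 < t := by positivity
  have hgrad := discIntegral_discBubble_mul_gradient_sq_le hR hq
  have hM : 0 ≤ discIntegral R (q ^ 2) :=
    discIntegral_nonneg hR fun x _ => by simpa using sq_nonneg _
  have hdiv : R ^ 2 * discIntegral R (q ^ 2) = 2 * discIntegral R (discBubble R * q ^ 2)
      + discIntegral R (discBubble R * (q * planeEuler q)) := by
    have h₀ := discIntegral_pderiv_discBubble_mul hR 0 (X 0 * q ^ 2)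
    have h₁ := discIntegral_pderiv_discBubble_mul hR 1 (X 1 * q ^ 2)
    have h : pderiv 0 (discBubble R * (X 0 * q ^ 2)) + pderiv 1 (discBubble R * (X 1 * q ^ 2)) =
        (4 : ℝ) • (discBubble R * q ^ 2) + (2 : ℝ) • (discBubble R * (q * planeEuler q))
          - (2 * R ^ 2) • q ^ 2 := by
      simp only [discBubble, pderiv_mul, planeEuler_apply, map_sub, pderiv_C, pderiv_X_self,
        pderiv_pow, pderiv_X_of_ne (show (0 : Fin 2) ≠ 1 by decide),
        pderiv_X_of_ne (show (1 : Fin 2) ≠ 0 by decide), smul_eq_C_mul, map_mul, map_ofNat]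
      push_cast
      ring
    have := congrArg (discIntegral R) h
    rw [map_add, h₀, h₁] at this
    simp only [map_sub, map_add, map_smul, smul_eq_mul] at this
    linarith
  have hcs : 0 ≤ t ^ 2 * discIntegral R (discBubble R * q ^ 2)
      - 2 * t * discIntegral R (discBubble R * (q * planeEuler q))
      + R ^ 2 * discIntegral R (discBubble R * (pderiv 0 q ^ 2 + pderiv 1 q ^ 2)) := by
    have h : 0 ≤ discIntegral R ((t ^ 2) • (discBubble R * q ^ 2)
        - (2 * t) • (discBubble R * (q * planeEuler q))
        + (R ^ 2) • (discBubble R * (pderiv 0 q ^ 2 + pderiv 1 q ^ 2))) := by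
      refine discIntegral_nonneg hR fun x hx => ?_
      have hρ := eval_discBubble R x
      rw [Fin.sum_univ_two] at hρ
      simp only [map_add, map_sub, map_mul, map_pow, smul_eval, planeEuler_apply, eval_X]
      set ρ := eval x (discBubble R)
      set a := eval x (pderiv 0 q)
      set b := eval x (pderiv 1 q)
      set c := eval x q
      have : t ^ 2 * (ρ * c ^ 2) - 2 * t * (ρ * (c * (x 0 * a + x 1 * b)))
          + R ^ 2 * (ρ * (a ^ 2 + b ^ 2)) =
          ρ * ((t * c - (x 0 * a + x 1 * b)) ^ 2 + (x 0 * b - x 1 * a) ^ 2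
            + ρ * (a ^ 2 + b ^ 2)) := by
        rw [show R ^ 2 = ρ + (x 0 ^ 2 + x 1 ^ 2) by linarith]
        ring
      rw [this]
      positivity
    simpa only [map_sub, map_add, map_smul, smul_eq_mul] using h
  set M := discIntegral R (q ^ 2)
  set W := discIntegral R (discBubble R * q ^ 2)
  set G := discIntegral R (discBubble R * (pderiv 0 q ^ 2 + pderiv 1 q ^ 2))
  have hG : R ^ 2 * G ≤ t * (R ^ 2 * M) := by
    have : G ≤ t * M := hgrad.trans (by rw [ht]; nlinarith)
    nlinarith [mul_le_mul_of_nonneg_left this (sq_nonneg R)]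
  have : t * (R ^ 2 * M) ≤ t * ((t + 4) * W) := by nlinarith
  exact le_of_mul_le_mul_left this ht0

theorem discIntegral_gradient_sq_le {R : ℝ} (hR : 0 < R) {k : ℕ}
    {v : MvPolynomial (Fin 2) ℝ} (hv : v ∈ restrictTotalDegree (Fin 2) ℝ (k + 1)) :
    R ^ 2 * discIntegral R (pderiv 0 v ^ 2 + pderiv 1 v ^ 2) ≤
      ((k + 1) ^ 2 + 4) * ((k + 1) * (k + 3)) * discIntegral R (v ^ 2) := by
  have h₀ := discIntegral_sq_le_discBubble_mul hR (pderiv_mem_restrictTotalDegree 0 hv)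
  have h₁ := discIntegral_sq_le_discBubble_mul hR (pderiv_mem_restrictTotalDegree 1 hv)
  have h := mul_le_mul_of_nonneg_left (discIntegral_discBubble_mul_gradient_sq_le hR hv)
    (show (0 : ℝ) ≤ (k + 1) ^ 2 + 4 by positivity)
  rw [mul_add (discBubble R), map_add] at h
  push_cast at h
  rw [map_add]
  linarith

/-- **`H¹–L₂` inverse inequality on the disc** (Lemma `new_lemma_disk`).
For every `R > 0`, `p ∈ ℕ`, and every real polynomial `v` in two variables of total degree
at most `p`,
`∫_{B(0,R)} |∇v|² dx ≤ 9 p (p+1)² (p+2) R⁻² ∫_{B(0,R)} v² dx`. -/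
theorem H1_L2_inverse_inequality_disc
    (R : ℝ) (hR : 0 < R) (p : ℕ)
    (v : MvPolynomial (Fin 2) ℝ) (hv : v.totalDegree ≤ p) :
    ∫ x in Metric.ball (0 : EuclideanSpace ℝ (Fin 2)) R,
        (∑ i : Fin 2, (MvPolynomial.eval (fun j => x j) (MvPolynomial.pderiv i v)) ^ 2) ≤
      9 * (p : ℝ) * ((p : ℝ) + 1) ^ 2 * ((p : ℝ) + 2) / R ^ 2 *
        ∫ x in Metric.ball (0 : EuclideanSpace ℝ (Fin 2)) R,
          (MvPolynomial.eval (fun j => x j) v) ^ 2 := by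
  have hI (f : MvPolynomial (Fin 2) ℝ) := discIntegral_apply R (f ^ 2)
  simp only [map_pow] at hI
  have hg : ∫ x in Metric.ball (0 : EuclideanSpace ℝ (Fin 2)) R,
      (∑ i : Fin 2, (MvPolynomial.eval (fun j => x j) (MvPolynomial.pderiv i v)) ^ 2) =
      discIntegral R (pderiv 0 v ^ 2 + pderiv 1 v ^ 2) := by
    simp [discIntegral_apply, Fin.sum_univ_two]
  rw [hg, ← hI, div_mul_eq_mul_div, le_div_iff₀' (by positivity)]
  rcases p with _ | k
  · rw [totalDegree_eq_zero_iff_eq_C.1 (Nat.le_zero.1 hv)]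
    simp
  · refine (discIntegral_gradient_sq_le hR ((mem_restrictTotalDegree _ _ _).2 hv)).trans ?_
    refine mul_le_mul_of_nonneg_right ?_
      (discIntegral_nonneg hR fun x _ => by simpa using sq_nonneg _)
    have hk : (0 : ℝ) ≤ k := Nat.cast_nonneg k
    push_cast
    have : ((k : ℝ) + 1) ^ 2 + 4 ≤ 9 * (k + 1 + 1) ^ 2 := by nlinarith
    calc (((k : ℝ) + 1) ^ 2 + 4) * (((k : ℝ) + 1) * (k + 3))
        ≤ 9 * ((k : ℝ) + 1 + 1) ^ 2 * ((k + 1) * (k + 3)) := by gcongr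
      _ = 9 * ((k : ℝ) + 1) * (k + 1 + 1) ^ 2 * (k + 1 + 2) := by ring
end
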